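/- arXiv:1909.06430 — 4 statements merged into one kernel-verified Lean document; each statement's English description precedes it below -/
import Mathlib

section
/- For any δ ∈ (0, 1 − 1/q), ε > 0, and prime power q, there exists s₀ ≥ 1 such that for every s ≥ s₀ and every rate R ≤ 1 − h_q(δ) − ε, the probability that a random s-LDPC code of rate R and length n over F_q has relative distance at least δ (i.e., every nonzero codeword has relative Hamming weight at least δ) tends to 1 as n → ∞ (over admissible lengths n). -/
/-- Probability of an event under the uniform distribution on a finite type. -/
noncomputable def unifProb {α : Type} [Fintype α] (E : Set α) : ℝ :=
  (Nat.card E : ℝ) / (Fintype.card α : ℝ)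

/-- The linear code defined as the kernel of a parity-check matrix. -/
def codeOf {F : Type} [Field F] {m n : ℕ} (H : Matrix (Fin m) (Fin n) F) :
    Set (Fin n → F) := {x | H.mulVec x = 0}

/-- Probability that the kernel of a uniformly random `m × n` matrix over `F`
(a random linear code with `m` parity checks) satisfies the predicate `P`. -/
noncomputable def rlcProb (F : Type) [Field F] [Fintype F] (n m : ℕ)
    (P : Set (Fin n → F) → Prop) : ℝ :=
  unifProb {H : Matrix (Fin m) (Fin n) F | P (codeOf H)}

/-- The block matrix `F = (F_1 | ... | F_{n/s})`, where `F_i` has all-ones `i`-th row and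
all other rows zero: entry `(r, j)` is `1` iff `⌊j/s⌋ = r`. -/
def Fmat (F : Type) [Field F] (n s : ℕ) : Matrix (Fin (n / s)) (Fin n) F :=
  Matrix.of fun r j => if j.val / s = r.val then 1 else 0

/-- The permutation matrix of a permutation of `Fin n`. -/
def permMat (F : Type) [Field F] {n : ℕ} (π : Equiv.Perm (Fin n)) :
    Matrix (Fin n) (Fin n) F :=
  Matrix.of fun i j => if π j = i then 1 else 0

/-- Sample space for a random `s`-LDPC code with `t` independent layers: each layer is
determined by a uniformly random permutation of `Fin n` together with i.i.d. uniform
nonzero diagonal entries. -/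
abbrev LdpcSample (F : Type) [Monoid F] (n t : ℕ) : Type :=
  Fin t → Equiv.Perm (Fin n) × (Fin n → Fˣ)

/-- One layer `F·Π·D` of the parity-check matrix of a random `s`-LDPC code. -/
def layerMat (F : Type) [Field F] (n s : ℕ)
    (ω : Equiv.Perm (Fin n) × (Fin n → Fˣ)) : Matrix (Fin (n / s)) (Fin n) F :=
  Fmat F n s * permMat F ω.1 * Matrix.diagonal (fun i => (ω.2 i : F))

/-- The `s`-LDPC code determined by the sample `ω` of `t` layers: the kernel of the
matrix obtained by stacking the `t` layers. -/
def ldpcCode (F : Type) [Field F] (n s t : ℕ) (ω : LdpcSample F n t) :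
    Set (Fin n → F) :=
  {x | ∀ i : Fin t, (layerMat F n s (ω i)).mulVec x = 0}

/-- Probability that a random `s`-LDPC code with `t` layers satisfies predicate `P`. -/
noncomputable def ldpcProb (F : Type) [Field F] [Fintype F] [DecidableEq F] (n s t : ℕ)
    (P : Set (Fin n → F) → Prop) : ℝ :=
  unifProb {ω : LdpcSample F n t | P (ldpcCode F n s t ω)}

/-- `(α, L)`-list-decodability: every Hamming ball of relative radius `α` contains at most
`L` codewords. -/
def ListDecodable {F : Type} [DecidableEq F] {n : ℕ} (α : ℝ) (L : ℕ)
    (C : Set (Fin n → F)) : Prop :=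
  ∀ z : Fin n → F,
    Nat.card {c : Fin n → F | c ∈ C ∧ (hammingDist c z : ℝ) ≤ α * n} ≤ L


/-- The `q`-ary entropy function. -/
noncomputable def qEntropy (q : ℕ) (x : ℝ) : ℝ :=
  x * Real.logb q (q - 1) - x * Real.logb q x - (1 - x) * Real.logb q (1 - x)

/-- The relative Hamming weight of a vector. -/
noncomputable def relWt {F : Type} [DecidableEq F] [Zero F] {n : ℕ} (x : Fin n → F) : ℝ :=
  ((Finset.univ.filter fun i : Fin n => x i ≠ 0).card : ℝ) / n

section Counting

variable {F : Type} [Field F]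

/-- The set of vectors all of whose consecutive length-`s` blocks sum to zero. -/
def blockKernel (F : Type) [Field F] (n s : ℕ) : Set (Fin n → F) :=
  {y | ∀ r : Fin (n / s), ∑ j : Fin n, (if j.val / s = r.val then y j else 0) = 0}

theorem mem_blockKernel_iff (m s : ℕ) (hs : 0 < s) (y : Fin (m * s) → F) :
    y ∈ blockKernel F (m * s) s ↔ ∀ r : Fin m, ∑ j : Fin s, y (finProdFinEquiv (r, j)) = 0 := by
  have key : ∀ r : Fin m,
      ∑ j : Fin (m * s), (if j.val / s = r.val then y j else 0) =
        ∑ j : Fin s, y (finProdFinEquiv (r, j)) := by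
    intro r
    rw [← finProdFinEquiv.sum_comp, Fintype.sum_prod_type]
    have h1 : ∀ (a : Fin m) (j : Fin s), ((finProdFinEquiv (a, j)).val / s = r.val) ↔ a = r := by
      intro a j
      have : (finProdFinEquiv (a, j)).val / s = a.val := by
        simp [finProdFinEquiv, Nat.add_mul_div_left _ _ hs, Nat.div_eq_of_lt j.2]
      rw [this, Fin.ext_iff]
    simp only [h1]
    rw [Finset.sum_eq_single r]
    · simp
    · intro b _ hb; simp [hb]
    · simp
  have hm : m * s / s = m := Nat.mul_div_cancel m hs
  constructor
  · intro h r
    rw [← key]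
    exact h ⟨r.val, by rw [hm]; exact r.2⟩
  · intro h r
    have := h ⟨r.val, by exact r.2.trans_eq hm⟩
    rw [← key] at this
    exact this

variable [DecidableEq F]

theorem pow_hammingNorm_eq_prod {ι : Type} [Fintype ι] {M : Type*} [CommMonoid M] (z : M)
    (y : ι → F) : z ^ hammingNorm y = ∏ i, if y i = 0 then 1 else z := by
  simp [hammingNorm, Finset.prod_ite]

variable [Fintype F]

theorem sum_weight_eq (z : ℝ) :
    ∑ a : F, (if a = 0 then 1 else z) = 1 + (Fintype.card F - 1) * z := by
  have h : ∀ a : F, (if a = 0 then 1 else z) = (if a = 0 then 1 - z else 0) + z := by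
    intro a; split_ifs <;> ring
  simp only [h, Finset.sum_add_distrib, Finset.sum_ite_eq', Finset.mem_univ, if_true]
  simp
  ring

/-- The weight enumerator of the vectors with a prescribed coordinate sum. -/
theorem sum_prod_weight_of_sum_eq (z : ℝ) (s : ℕ) (c : F) :
    ∑ y : Fin s → F, (if ∑ i, y i = c then ∏ i, (if y i = 0 then 1 else z) else 0) =
      ((1 + (Fintype.card F - 1) * z) ^ s +
        (if c = 0 then (Fintype.card F : ℝ) - 1 else -1) * (1 - z) ^ s) / Fintype.card F := by
  have hq : (Fintype.card F : ℝ) ≠ 0 := by exact_mod_cast Fintype.card_ne_zero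
  induction s generalizing c with
  | zero =>
    by_cases hc : c = 0
    · simp [hc, hq]
    · simp [hc, Ne.symm hc]
  | succ s ih =>
    rw [← (Fin.consEquiv (fun _ : Fin (s + 1) => F)).sum_comp, Fintype.sum_prod_type]
    have h1 : ∀ a : F, ∑ y : Fin s → F,
        (if ∑ i, (Fin.consEquiv (fun _ : Fin (s + 1) => F)) (a, y) i = c then
          ∏ i, (if (Fin.consEquiv (fun _ : Fin (s + 1) => F)) (a, y) i = 0 then 1 else z) else 0) =
        (if a = 0 then 1 else z) * (((1 + (Fintype.card F - 1) * z) ^ s +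
          ((if a = c then (Fintype.card F : ℝ) else 0) - 1) * (1 - z) ^ s) / Fintype.card F) := by
      intro a
      have := ih (c - a)
      have h2 : (if c - a = 0 then (Fintype.card F : ℝ) - 1 else -1) =
          (if a = c then (Fintype.card F : ℝ) else 0) - 1 := by
        by_cases h : a = c
        · simp [h]
        · simp [h, sub_eq_zero, Ne.symm h]
      rw [h2] at this
      rw [← this, Finset.mul_sum]
      refine Finset.sum_congr rfl fun y _ => ?_
      simp [Fin.sum_univ_succ, Fin.prod_univ_succ, Fin.consEquiv, eq_sub_iff_add_eq']
    simp only [h1]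
    have h3 : ∀ a : F, (if a = 0 then 1 else z) * (((1 + (Fintype.card F - 1) * z) ^ s +
          ((if a = c then (Fintype.card F : ℝ) else 0) - 1) * (1 - z) ^ s) / Fintype.card F) =
        (if a = 0 then 1 else z) *
            (((1 + (Fintype.card F - 1) * z) ^ s - (1 - z) ^ s) / Fintype.card F) +
          (if a = c then (if a = 0 then 1 else z) * (1 - z) ^ s else 0) := by
      intro a
      by_cases h : a = c
      · simp only [h, if_true]; field_simp; ring
      · simp only [h, if_false]; ring
    simp only [h3, Finset.sum_add_distrib, ← Finset.sum_mul, sum_weight_eq, Finset.sum_ite_eq',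
      Finset.mem_univ, if_true]
    by_cases hc : c = 0
    · simp only [hc, if_true]; field_simp; ring
    · simp only [hc, if_false]; field_simp; ring

open Classical in
/-- The weight enumerator of `blockKernel`. -/
theorem sum_pow_hammingNorm_blockKernel (z : ℝ) (m s : ℕ) (hs : 0 < s) :
    ∑ y : Fin (m * s) → F, (if y ∈ blockKernel F (m * s) s then z ^ hammingNorm y else 0) =
      (((1 + (Fintype.card F - 1) * z) ^ s +
        ((Fintype.card F : ℝ) - 1) * (1 - z) ^ s) / Fintype.card F) ^ m := by
  have h0 := sum_prod_weight_of_sum_eq (F := F) z s 0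
  rw [if_pos rfl] at h0
  rw [← h0]
  have h1 := Finset.prod_univ_sum (fun _ : Fin m => (Finset.univ : Finset (Fin s → F)))
    (fun _ y => if ∑ i, y i = 0 then ∏ i, (if y i = 0 then 1 else z) else 0)
  rw [Finset.prod_const, Finset.card_univ, Fintype.card_fin, Fintype.piFinset_univ] at h1
  rw [h1]
  let e : (Fin (m * s) → F) ≃ (Fin m → Fin s → F) :=
    (Equiv.arrowCongr finProdFinEquiv.symm (Equiv.refl F)).trans (Equiv.curry _ _ _)
  have he : ∀ y r j, e y r j = y (finProdFinEquiv (r, j)) := fun _ _ _ => rfl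
  rw [← e.sum_comp]
  refine Finset.sum_congr rfl fun y _ => ?_
  simp only [he]
  rw [mem_blockKernel_iff m s hs, pow_hammingNorm_eq_prod, ← finProdFinEquiv.prod_comp,
    Fintype.prod_prod_type]
  by_cases h : ∀ r : Fin m, ∑ j : Fin s, y (finProdFinEquiv (r, j)) = 0
  · simp [h]
  · rw [if_neg h]
    push Not at h
    obtain ⟨r, hr⟩ := h
    exact (Finset.prod_eq_zero (Finset.mem_univ r) (if_neg hr)).symm

/-- The number of vectors of a given Hamming weight. -/
theorem card_hammingNorm_eq (n w : ℕ) :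
    (Finset.univ.filter fun x : Fin n → F => hammingNorm x = w).card =
      n.choose w * (Fintype.card F - 1) ^ w := by
  have h1 := Finset.prod_univ_sum (fun _ : Fin n => (Finset.univ : Finset F))
    (fun _ a => if a = 0 then (1 : Polynomial ℕ) else Polynomial.X)
  simp only [Fintype.piFinset_univ, ← pow_hammingNorm_eq_prod] at h1
  have h2 : ∑ a : F, (if a = 0 then (1 : Polynomial ℕ) else Polynomial.X) =
      Polynomial.C (Fintype.card F - 1) * Polynomial.X + 1 := by
    rw [Finset.sum_ite, Finset.filter_eq', Finset.filter_ne']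
    simp [add_comm]
  rw [h2, Finset.prod_const, Finset.card_univ, Fintype.card_fin] at h1
  have h3 := congrArg (fun p => Polynomial.coeff p w) h1
  simp only [Polynomial.finsetSum_coeff, Polynomial.coeff_X_pow] at h3
  rw [Finset.card_filter]
  simp only [eq_comm (a := w)] at h3
  rw [← h3, add_pow, Polynomial.finsetSum_coeff]
  simp only [one_pow, mul_one, mul_pow, ← Polynomial.C_pow]
  simp only [Polynomial.coeff_mul_natCast, Polynomial.coeff_C_mul, Polynomial.coeff_X_pow]
  simp only [mul_ite, mul_one, mul_zero, ite_mul, zero_mul]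
  rw [Finset.sum_ite_eq]
  split_ifs with h
  · simp [mul_comm]
  · rw [Finset.mem_range, not_lt] at h
    simp [Nat.choose_eq_zero_of_lt (show n < w by omega)]

end Counting

section Layer

variable {F : Type} [Field F]

/-- The action of a permutation together with a nonzero diagonal matrix on vectors. -/
def layerAct {n : ℕ} (ω : Equiv.Perm (Fin n) × (Fin n → Fˣ)) (x : Fin n → F) : Fin n → F :=
  fun i => (ω.2 (ω.1.symm i) : F) * x (ω.1.symm i)

theorem layerAct_apply {n : ℕ} (ω : Equiv.Perm (Fin n) × (Fin n → Fˣ)) (x : Fin n → F)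
    (i : Fin n) : layerAct ω x (ω.1 i) = (ω.2 i : F) * x i := by
  simp [layerAct]

theorem layerMat_mulVec_eq_zero_iff {n s : ℕ} (ω : Equiv.Perm (Fin n) × (Fin n → Fˣ))
    (x : Fin n → F) :
    (layerMat F n s ω).mulVec x = 0 ↔ layerAct ω x ∈ blockKernel F n s := by
  have h1 : (permMat F ω.1).mulVec ((Matrix.diagonal fun i => (ω.2 i : F)).mulVec x) =
      layerAct ω x := by
    funext i
    simp only [Matrix.mulVec, dotProduct, permMat, Matrix.of_apply, Matrix.diagonal_apply,
      ite_mul, zero_mul, one_mul, Finset.sum_ite_eq, Finset.mem_univ, if_true]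
    rw [Finset.sum_eq_single (ω.1.symm i)]
    · simp [layerAct]
    · intro j _ hj
      rw [if_neg]
      rintro rfl
      simp at hj
    · simp
  rw [layerMat, ← Matrix.mulVec_mulVec, ← Matrix.mulVec_mulVec, h1, funext_iff]
  refine forall_congr' fun r => ?_
  simp [Matrix.mulVec, dotProduct, Fmat, ite_mul]

theorem layerAct_layerAct {n : ℕ} (ω ω' : Equiv.Perm (Fin n) × (Fin n → Fˣ)) (x : Fin n → F) :
    layerAct ω (layerAct ω' x) =
      layerAct (ω.1 * ω'.1, fun j => ω.2 (ω'.1 j) * ω'.2 j) x := by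
  funext i
  simp [layerAct, Equiv.Perm.mul_def, mul_assoc]

theorem layerAct_injective {n : ℕ} (ω : Equiv.Perm (Fin n) × (Fin n → Fˣ)) :
    Function.Injective (layerAct (F := F) ω) := by
  intro x y h
  funext i
  have := congrFun h (ω.1 i)
  simpa [layerAct_apply] using this

variable [DecidableEq F]

theorem hammingNorm_layerAct {n : ℕ} (ω : Equiv.Perm (Fin n) × (Fin n → Fˣ)) (x : Fin n → F) :
    hammingNorm (layerAct ω x) = hammingNorm x := by
  symm
  refine Finset.card_equiv ω.1 fun i => ?_
  simp [layerAct_apply]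

theorem exists_layerAct_eq {n : ℕ} {x y : Fin n → F} (h : hammingNorm x = hammingNorm y) :
    ∃ ω : Equiv.Perm (Fin n) × (Fin n → Fˣ), layerAct ω x = y := by
  have hc : Fintype.card {i // x i ≠ 0} = Fintype.card {i // y i ≠ 0} := by
    rw [Fintype.card_subtype, Fintype.card_subtype]
    exact h
  let e := Fintype.equivOfCardEq hc
  let π := e.extendSubtype
  have h1 : ∀ i, x i ≠ 0 → y (π i) ≠ 0 := fun i hi => e.extendSubtype_mem i hi
  have h2 : ∀ i, ¬ x i ≠ 0 → ¬ y (π i) ≠ 0 := fun i hi => e.extendSubtype_not_mem i hi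
  refine ⟨(π, fun i => if hi : x i ≠ 0 then Units.mk0 (y (π i)) (h1 i hi) * (Units.mk0 (x i) hi)⁻¹
    else 1), ?_⟩
  funext k
  obtain ⟨i, rfl⟩ := π.surjective k
  refine (layerAct_apply _ x i).trans ?_
  by_cases hi : x i ≠ 0
  · simp [hi]
  · have := h2 i hi
    simp only [not_not] at hi this
    simp [hi, this]

variable [Fintype F]

open Classical in
theorem card_layerAct_mem_le (n : ℕ) (K : Set (Fin n → F)) {x y : Fin n → F}
    (h : hammingNorm x = hammingNorm y) :
    (Finset.univ.filter fun ω : Equiv.Perm (Fin n) × (Fin n → Fˣ) => layerAct ω y ∈ K).card ≤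
      (Finset.univ.filter fun ω : Equiv.Perm (Fin n) × (Fin n → Fˣ) => layerAct ω x ∈ K).card := by
  obtain ⟨ω', rfl⟩ := exists_layerAct_eq h
  refine Finset.card_le_card_of_injOn
    (fun ω => (ω.1 * ω'.1, fun j => ω.2 (ω'.1 j) * ω'.2 j)) ?_ ?_
  · intro ω hω
    simp only [Finset.coe_filter, Finset.mem_univ, true_and, Set.mem_ofPred_eq] at hω ⊢
    rwa [layerAct_layerAct] at hω
  · rintro ⟨π₁, d₁⟩ _ ⟨π₂, d₂⟩ _ hω
    simp only [Prod.mk.injEq, mul_left_inj] at hω ⊢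
    refine ⟨hω.1, funext fun i => ?_⟩
    have := congrFun hω.2 (ω'.1.symm i)
    simpa using this

open Classical in
/-- A layer maps a vector to a uniformly random vector of the same weight. -/
theorem card_layerAct_mem_mul (n : ℕ) (K : Set (Fin n → F)) (x : Fin n → F) :
    (Finset.univ.filter fun ω : Equiv.Perm (Fin n) × (Fin n → Fˣ) => layerAct ω x ∈ K).card *
        (Finset.univ.filter fun y : Fin n → F => hammingNorm y = hammingNorm x).card =
      Fintype.card (Equiv.Perm (Fin n) × (Fin n → Fˣ)) *
        (Finset.univ.filter fun y : Fin n → F => hammingNorm y = hammingNorm x ∧ y ∈ K).card := by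
  have h1 := Finset.sum_card_bipartiteAbove_eq_sum_card_bipartiteBelow
    (s := Finset.univ.filter fun y : Fin n → F => hammingNorm y = hammingNorm x)
    (t := (Finset.univ : Finset (Equiv.Perm (Fin n) × (Fin n → Fˣ))))
    (fun y ω => layerAct ω y ∈ K)
  have h2 : ∀ y ∈ Finset.univ.filter fun y : Fin n → F => hammingNorm y = hammingNorm x,
      (Finset.bipartiteAbove (fun y ω => layerAct ω y ∈ K)
        (Finset.univ : Finset (Equiv.Perm (Fin n) × (Fin n → Fˣ))) y).card =
      (Finset.univ.filter fun ω : Equiv.Perm (Fin n) × (Fin n → Fˣ) =>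
        layerAct ω x ∈ K).card := by
    intro y hy
    have hy : hammingNorm y = hammingNorm x := by simpa using hy
    exact le_antisymm (card_layerAct_mem_le n K hy.symm) (card_layerAct_mem_le n K hy)
  have h3 : ∀ ω ∈ (Finset.univ : Finset (Equiv.Perm (Fin n) × (Fin n → Fˣ))),
      (Finset.bipartiteBelow (fun y ω => layerAct ω y ∈ K)
        (Finset.univ.filter fun y : Fin n → F => hammingNorm y = hammingNorm x) ω).card =
      (Finset.univ.filter fun y : Fin n → F =>
        hammingNorm y = hammingNorm x ∧ y ∈ K).card := by
    intro ω _
    have hb : Function.Bijective (layerAct (F := F) ω) :=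
      (Finite.injective_iff_bijective).1 (layerAct_injective ω)
    refine Finset.card_equiv (Equiv.ofBijective _ hb) fun y => ?_
    simp [Finset.bipartiteBelow, hammingNorm_layerAct]
  rw [Finset.sum_congr rfl h2, Finset.sum_congr rfl h3, Finset.sum_const, Finset.sum_const,
    smul_eq_mul, smul_eq_mul, Finset.card_univ] at h1
  rw [mul_comm, h1]

open Classical in
/-- Union bound over the low-weight vectors. -/
theorem one_sub_sum_le_ldpcProb (n s t : ℕ) (δ : ℝ) (hn : 0 < n) :
    1 - ∑ w ∈ (Finset.range (n + 1)).filter (fun w : ℕ => 0 < w ∧ (w : ℝ) < δ * n),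
        ((n.choose w * (Fintype.card F - 1) ^ w : ℕ) : ℝ) *
          ((Finset.univ.filter fun y : Fin n → F =>
              hammingNorm y = w ∧ y ∈ blockKernel F n s).card /
            ((n.choose w * (Fintype.card F - 1) ^ w : ℕ) : ℝ)) ^ t ≤
      ldpcProb F n s t (fun C => ∀ x ∈ C, x ≠ 0 → δ ≤ relWt x) := by
  set G := Equiv.Perm (Fin n) × (Fin n → Fˣ) with hG
  set c : (Fin n → F) → ℕ := fun x =>
    (Finset.univ.filter fun ω : G => layerAct ω x ∈ blockKernel F n s).card with hc
  set B : Finset (Fin n → F) :=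
    Finset.univ.filter (fun x => 0 < hammingNorm x ∧ (hammingNorm x : ℝ) < δ * n) with hB
  have hn' : (0 : ℝ) < n := by exact_mod_cast hn
  have hGpos : (0 : ℝ) < Fintype.card G := by exact_mod_cast Fintype.card_pos
  have hGt : (0 : ℝ) < (Fintype.card (Fin t → G) : ℝ) := by exact_mod_cast Fintype.card_pos
  have hcard : ∀ x : Fin n → F,
      (Finset.univ.filter fun ω : Fin t → G => x ∈ ldpcCode F n s t ω).card = c x ^ t := by
    intro x
    rw [hc, ← Fintype.card_piFinset_const]
    congr 1
    ext ω
    simp [ldpcCode, layerMat_mulVec_eq_zero_iff]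
  have hcov : (Finset.univ : Finset (Fin t → G)) ⊆
      (Finset.univ.filter fun ω : Fin t → G =>
        ∀ x ∈ ldpcCode F n s t ω, x ≠ 0 → δ ≤ relWt x) ∪
      B.biUnion fun x => Finset.univ.filter fun ω : Fin t → G => x ∈ ldpcCode F n s t ω := by
    intro ω _
    rw [Finset.mem_union]
    by_cases h : ∀ x ∈ ldpcCode F n s t ω, x ≠ 0 → δ ≤ relWt x
    · left; simpa using h
    · right
      push Not at h
      obtain ⟨x, hx, hx0, hw⟩ := h
      refine Finset.mem_biUnion.2 ⟨x, ?_, by simpa using hx⟩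
      rw [hB, Finset.mem_filter]
      refine ⟨Finset.mem_univ _, hammingNorm_pos_iff.2 hx0, ?_⟩
      have : relWt x = (hammingNorm x : ℝ) / n := rfl
      rwa [this, div_lt_iff₀ hn'] at hw
  have hle : Fintype.card (Fin t → G) ≤
      (Finset.univ.filter fun ω : Fin t → G =>
        ∀ x ∈ ldpcCode F n s t ω, x ≠ 0 → δ ≤ relWt x).card + ∑ x ∈ B, c x ^ t := by
    rw [← Finset.card_univ]
    refine (Finset.card_le_card hcov).trans ((Finset.card_union_le _ _).trans ?_)
    refine Nat.add_le_add_left (Finset.card_biUnion_le.trans ?_) _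
    exact Finset.sum_le_sum fun x _ => (hcard x).le
  have hprob : ldpcProb F n s t (fun C => ∀ x ∈ C, x ≠ 0 → δ ≤ relWt x) =
      ((Finset.univ.filter fun ω : Fin t → G =>
        ∀ x ∈ ldpcCode F n s t ω, x ≠ 0 → δ ≤ relWt x).card : ℝ) /
          Fintype.card (Fin t → G) := by
    unfold ldpcProb unifProb
    congr 2
    rw [Nat.card_eq_fintype_card, ← Fintype.card_subtype]
    rfl
  have hsum : ∑ w ∈ (Finset.range (n + 1)).filter (fun w : ℕ => 0 < w ∧ (w : ℝ) < δ * n),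
        ((n.choose w * (Fintype.card F - 1) ^ w : ℕ) : ℝ) *
          ((Finset.univ.filter fun y : Fin n → F =>
              hammingNorm y = w ∧ y ∈ blockKernel F n s).card /
            ((n.choose w * (Fintype.card F - 1) ^ w : ℕ) : ℝ)) ^ t =
      ∑ x ∈ B, ((c x : ℝ) / Fintype.card G) ^ t := by
    rw [← Finset.sum_fiberwise_of_maps_to (s := B) (g := fun x => hammingNorm x)]
    · refine Finset.sum_congr rfl fun w hw => ?_
      rw [Finset.mem_filter] at hw
      have hBw : B.filter (fun x => hammingNorm x = w) =
          Finset.univ.filter fun x : Fin n → F => hammingNorm x = w := by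
        ext x
        simp only [hB, Finset.mem_filter, Finset.mem_univ, true_and]
        constructor
        · exact fun h => h.2
        · rintro rfl; exact ⟨hw.2, rfl⟩
      rw [hBw, ← card_hammingNorm_eq, ← nsmul_eq_mul, ← Finset.sum_const]
      refine Finset.sum_congr rfl fun x hx => ?_
      have hx' : hammingNorm x = w := by simpa using hx
      subst hx'
      have hpos : (0 : ℝ) < (Finset.univ.filter fun y : Fin n → F =>
          hammingNorm y = hammingNorm x).card := by
        exact_mod_cast Finset.card_pos.2 ⟨x, hx⟩
      congr 1
      rw [div_eq_div_iff hpos.ne' hGpos.ne']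
      have := card_layerAct_mem_mul n (blockKernel F n s) x
      rw [mul_comm]
      exact_mod_cast this.symm
    · intro x hx
      rw [hB, Finset.mem_filter] at hx
      rw [Finset.mem_filter]
      refine ⟨Finset.mem_range.2 (Nat.lt_succ_of_le ?_), hx.2⟩
      simpa using hammingNorm_le_card_fintype (x := x)
  rw [hsum, hprob, le_div_iff₀ hGt]
  have hGe : (Fintype.card (Fin t → G) : ℝ) = (Fintype.card G : ℝ) ^ t := by
    rw [Fintype.card_fun, Fintype.card_fin]; push_cast; rfl
  have hmul : (∑ x ∈ B, ((c x : ℝ) / Fintype.card G) ^ t) * Fintype.card (Fin t → G) =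
      ∑ x ∈ B, (c x : ℝ) ^ t := by
    rw [hGe, Finset.sum_mul]
    refine Finset.sum_congr rfl fun x _ => ?_
    rw [← mul_pow, div_mul_cancel₀ _ hGpos.ne']
  rw [sub_mul, hmul, one_mul, sub_le_iff_le_add]
  exact_mod_cast hle

end Layer

section Binomial

theorem pow_div_le_choose {n w : ℕ} (hw : w ≤ n) : ((n : ℝ) / w) ^ w ≤ n.choose w := by
  rcases Nat.eq_zero_or_pos w with rfl | hpos
  · simp
  have key : ∀ k ≤ w, n ^ k * w.descFactorial k ≤ w ^ k * n.descFactorial k := by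
    intro k
    induction k with
    | zero => simp
    | succ k ih =>
      intro hk
      have h1 := ih (by omega)
      have h2 : n * (w - k) ≤ w * (n - k) := by
        rw [Nat.mul_sub, Nat.mul_sub, mul_comm w n]
        exact Nat.sub_le_sub_left (Nat.mul_le_mul_right k hw) _
      rw [Nat.descFactorial_succ, Nat.descFactorial_succ]
      calc n ^ (k + 1) * ((w - k) * w.descFactorial k)
          = (n * (w - k)) * (n ^ k * w.descFactorial k) := by ring
        _ ≤ (w * (n - k)) * (w ^ k * n.descFactorial k) := Nat.mul_le_mul h2 h1
        _ = _ := by ring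
  have h := key w le_rfl
  rw [Nat.descFactorial_self, Nat.descFactorial_eq_factorial_mul_choose] at h
  have h' : n ^ w ≤ w ^ w * n.choose w := by
    refine Nat.le_of_mul_le_mul_right ?_ w.factorial_pos
    linarith
  have hw0 : (0 : ℝ) < (w : ℝ) ^ w := by positivity
  rw [div_pow, div_le_iff₀ hw0, mul_comm]
  exact_mod_cast h'

theorem pow_le_succ_mul_choose_mul {n w : ℕ} (hw : w ≤ n) :
    n ^ n ≤ (n + 1) * (n.choose w * w ^ w * (n - w) ^ (n - w)) := by
  set b : ℕ → ℕ := fun k => n.choose k * w ^ k * (n - w) ^ (n - k) with hb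
  have hsucc : ∀ k < n, b (k + 1) * (k + 1) =
      n.choose k * w ^ k * (n - w) ^ (n - k - 1) * ((n - k) * w) := by
    intro k hk
    have := Nat.choose_succ_right_eq n k
    simp only [hb]
    rw [show n - (k + 1) = n - k - 1 by omega, pow_succ]
    linear_combination (w ^ k * w * (n - w) ^ (n - k - 1)) * this
  have hself : ∀ k < n, b k * (k + 1) =
      n.choose k * w ^ k * (n - w) ^ (n - k - 1) * ((k + 1) * (n - w)) := by
    intro k hk
    simp only [hb]
    conv_lhs => rw [show n - k = n - k - 1 + 1 by omega, pow_succ]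
    ring
  have hup : ∀ k < w, b k ≤ b (k + 1) := by
    intro k hk
    refine Nat.le_of_mul_le_mul_right (c := k + 1) ?_ k.succ_pos
    rw [hsucc k (by omega), hself k (by omega)]
    refine Nat.mul_le_mul_left _ ?_
    zify [hw, show k ≤ n by omega]
    have : (k : ℤ) + 1 ≤ w := by exact_mod_cast hk
    nlinarith
  have hdown : ∀ k, w ≤ k → k < n → b (k + 1) ≤ b k := by
    intro k hk hkn
    refine Nat.le_of_mul_le_mul_right (c := k + 1) ?_ k.succ_pos
    rw [hsucc k (by omega), hself k (by omega)]
    refine Nat.mul_le_mul_left _ ?_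
    zify [hw, show k ≤ n by omega]
    have h1 : (w : ℤ) ≤ k := by exact_mod_cast hk
    have h2 : (w : ℤ) ≤ n := by exact_mod_cast hw
    nlinarith
  have hmax1 : ∀ k ≤ w, b k ≤ b w := by
    intro k hk
    exact Nat.decreasingInduction' (P := fun k => b k ≤ b w)
      (fun j hj _ ih => (hup j hj).trans ih) hk le_rfl
  have hmax2 : ∀ k, w ≤ k → k ≤ n → b k ≤ b w := by
    intro k hk
    induction k, hk using Nat.le_induction with
    | base => exact fun _ => le_rfl
    | succ k hk ih => exact fun hkn => (hdown k hk (by omega)).trans (ih (by omega))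
  have hsum : n ^ n = ∑ k ∈ Finset.range (n + 1), b k := by
    conv_lhs => rw [show n ^ n = (w + (n - w)) ^ n by rw [Nat.add_sub_cancel' hw], add_pow]
    refine Finset.sum_congr rfl fun k _ => ?_
    simp only [hb, Nat.cast_id]
    ring
  rw [hsum]
  calc ∑ k ∈ Finset.range (n + 1), b k ≤ ∑ _k ∈ Finset.range (n + 1), b w := by
        refine Finset.sum_le_sum fun k hk => ?_
        rw [Finset.mem_range] at hk
        rcases le_total k w with h | h
        · exact hmax1 k h
        · exact hmax2 k h (by omega)
    _ = _ := by simp [hb]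

theorem choose_mul_pow_mul_pow_le_one {n w : ℕ} (hw : w ≤ n) {p : ℝ} (h0 : 0 ≤ p)
    (h1 : p ≤ 1) : n.choose w * (p ^ w * (1 - p) ^ (n - w)) ≤ 1 := by
  have h := add_pow p (1 - p) n
  rw [add_sub_cancel, one_pow] at h
  have := Finset.single_le_sum (s := Finset.range (n + 1))
    (f := fun k => p ^ k * (1 - p) ^ (n - k) * (n.choose k : ℝ)) (fun k _ => by
      have : 0 ≤ 1 - p := by linarith
      positivity) (Finset.mem_range.2 (Nat.lt_succ_of_le hw))
  rw [mul_comm]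
  exact this.trans_eq h.symm

theorem one_le_succ_mul_choose_mul_pow_mul_pow {n w : ℕ} (hn : 0 < n) (hw : w ≤ n) :
    1 ≤ (n + 1) * (n.choose w * (((w : ℝ) / n) ^ w * (1 - (w : ℝ) / n) ^ (n - w))) := by
  have hn' : (0 : ℝ) < n := by exact_mod_cast hn
  have h : (n : ℝ) ^ n ≤ (n + 1) * (n.choose w * (w : ℝ) ^ w * ((n : ℝ) - w) ^ (n - w)) := by
    have := pow_le_succ_mul_choose_mul hw
    rw [← Nat.cast_sub hw]
    exact_mod_cast this
  have e : (1 - (w : ℝ) / n) = ((n : ℝ) - w) / n := by field_simp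
  have e2 : (n : ℝ) ^ n = (n : ℝ) ^ w * (n : ℝ) ^ (n - w) := by
    rw [← pow_add, Nat.add_sub_cancel' hw]
  rw [e, div_pow, div_pow, div_mul_div_comm, ← e2, mul_div_assoc', mul_div_assoc',
    le_div_iff₀ (by positivity), one_mul]
  linarith

theorem exp_qaryEntropy_mul {q n w : ℕ} (hq : 2 ≤ q) (hw0 : 0 < w) (hwn : w < n) :
    Real.exp (n * Real.qaryEntropy q ((w : ℝ) / n)) *
      (((w : ℝ) / n) ^ w * (1 - (w : ℝ) / n) ^ (n - w)) = ((q : ℝ) - 1) ^ w := by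
  have hn' : (0 : ℝ) < n := by exact_mod_cast (by omega : 0 < n)
  have hw' : (0 : ℝ) < w := by exact_mod_cast hw0
  have hwn' : (w : ℝ) < n := by exact_mod_cast hwn
  have hq' : (0 : ℝ) < (q : ℝ) - 1 := by
    have : (2 : ℝ) ≤ q := by exact_mod_cast hq
    linarith
  have hp : 0 < (w : ℝ) / n := by positivity
  have hp1 : 0 < 1 - (w : ℝ) / n := by
    rw [sub_pos, div_lt_one hn']; exact hwn'
  have e1 : ((w : ℝ) / n) ^ w = Real.exp (w * Real.log ((w : ℝ) / n)) := by
    rw [mul_comm, Real.exp_mul, Real.exp_log hp, Real.rpow_natCast]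
  have e2 : (1 - (w : ℝ) / n) ^ (n - w) = Real.exp (((n : ℝ) - w) * Real.log (1 - (w : ℝ) / n)) := by
    rw [mul_comm, Real.exp_mul, Real.exp_log hp1, ← Nat.cast_sub hwn.le, Real.rpow_natCast]
  have e3 : ((q : ℝ) - 1) ^ w = Real.exp (w * Real.log ((q : ℝ) - 1)) := by
    rw [mul_comm, Real.exp_mul, Real.exp_log hq', Real.rpow_natCast]
  rw [e1, e2, e3, ← Real.exp_add, ← Real.exp_add]
  congr 1
  simp only [Real.qaryEntropy, Real.binEntropy, Real.log_inv]
  push_cast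
  have : (n : ℝ) * ((w : ℝ) / n) = w := by field_simp
  linear_combination (Real.log ((q : ℝ) - 1) - Real.log ((w : ℝ) / n) +
    Real.log (1 - (w : ℝ) / n)) * this

end Binomial

section FirstMoment

/-- The expected number of codewords of weight `w` when `w` is comparable with `n`. -/
theorem first_moment_dense {q n w s m t : ℕ} {N : ℝ} (hq : 2 ≤ q) (hw0 : 0 < w)
    (hn : n = m * s) (hwn : (w : ℝ) / n < 1 - 1 / q) (hN0 : 0 ≤ N)
    (hN : ∀ z : ℝ, 0 ≤ z → z ≤ 1 →
      N * z ^ w ≤ (((1 + ((q : ℝ) - 1) * z) ^ s + ((q : ℝ) - 1) * (1 - z) ^ s) / q) ^ m)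
    (hn0 : 0 < n) :
    (n.choose w * ((q : ℝ) - 1) ^ w) * (N / (n.choose w * ((q : ℝ) - 1) ^ w)) ^ t ≤
      (n + 1) ^ t * Real.exp (n * Real.qaryEntropy q ((w : ℝ) / n)) *
        ((1 + ((q : ℝ) - 1) * (1 - q / ((q : ℝ) - 1) * ((w : ℝ) / n)) ^ s) / q) ^ (m * t) := by
  have hq2 : (2 : ℝ) ≤ q := by exact_mod_cast hq
  have hq' : (0 : ℝ) < (q : ℝ) - 1 := by linarith
  have hn' : (0 : ℝ) < n := by exact_mod_cast hn0
  have hw' : (0 : ℝ) < w := by exact_mod_cast hw0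
  set p : ℝ := (w : ℝ) / n with hp
  have hp0 : 0 < p := by positivity
  have hp1 : p < 1 := hwn.trans (by rw [sub_lt_self_iff]; positivity)
  have hp1' : 0 < 1 - p := by linarith
  have hlt : w < n := by
    have := (div_lt_one hn').1 hp1
    exact_mod_cast this
  have hpq : q * p ≤ q - 1 := by
    have : (q : ℝ) * p ≤ q * (1 - 1 / q) := by gcongr
    rwa [mul_sub, mul_one, mul_one_div_cancel (by positivity)] at this
  set H := Real.exp (n * Real.qaryEntropy q p) with hH
  have hHeq := exp_qaryEntropy_mul hq hw0 hlt
  rw [← hp, ← hH] at hHeq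
  have hHpos : 0 < H := Real.exp_pos _
  set W : ℝ := n.choose w * ((q : ℝ) - 1) ^ w with hW
  have hD : 0 < p ^ w * (1 - p) ^ (n - w) := by positivity
  have hWH : W ≤ H := by
    have := choose_mul_pow_mul_pow_le_one hlt.le hp0.le hp1.le
    rw [hW, ← hHeq]
    calc (n.choose w : ℝ) * (H * (p ^ w * (1 - p) ^ (n - w)))
        = H * (n.choose w * (p ^ w * (1 - p) ^ (n - w))) := by ring
      _ ≤ H * 1 := by gcongr
      _ = H := mul_one H
  have hHW : H ≤ (n + 1) * W := by
    have := one_le_succ_mul_choose_mul_pow_mul_pow hn0 hlt.le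
    rw [← hp] at this
    rw [hW, ← hHeq]
    calc H = H * 1 := (mul_one H).symm
      _ ≤ H * ((n + 1) * (n.choose w * (p ^ w * (1 - p) ^ (n - w)))) := by gcongr
      _ = _ := by ring
  have hWpos : 0 < W := by
    have : 0 < n.choose w := Nat.choose_pos hlt.le
    positivity
  set η : ℝ := 1 - q / ((q : ℝ) - 1) * p with hη
  have hη0 : 0 ≤ η := by
    have : q / ((q : ℝ) - 1) * p ≤ 1 := by
      rw [div_mul_eq_mul_div, div_le_one hq']; exact hpq
    linarith
  set ρ : ℝ := (1 + ((q : ℝ) - 1) * η ^ s) / q with hρ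
  have hρ0 : 0 ≤ ρ := by positivity
  have hNH : N ≤ H * ρ ^ m := by
    set z : ℝ := p / (((q : ℝ) - 1) * (1 - p)) with hz
    have hz0 : 0 < z := by positivity
    have hz1 : z ≤ 1 := by
      rw [hz, div_le_one (by positivity)]; nlinarith
    have h1 := hN z hz0.le hz1
    have ha : 1 + ((q : ℝ) - 1) * z = 1 / (1 - p) := by rw [hz]; field_simp; ring
    have hb : 1 - z = η / (1 - p) := by rw [hz, hη]; field_simp; ring
    have hc : ((1 + ((q : ℝ) - 1) * z) ^ s + ((q : ℝ) - 1) * (1 - z) ^ s) / q =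
        ρ / (1 - p) ^ s := by
      rw [ha, hb, hρ, div_pow, div_pow, one_pow]; field_simp
    rw [hc, div_pow ρ, ← pow_mul, mul_comm s m, ← hn] at h1
    have hd : H * z ^ w = 1 / (1 - p) ^ n := by
      have hsplit : (1 - p) ^ n = (1 - p) ^ w * (1 - p) ^ (n - w) := by
        rw [← pow_add, Nat.add_sub_cancel' hlt.le]
      rw [hz, div_pow, mul_pow, ← hHeq, hsplit]
      field_simp
    have hzw : 0 < z ^ w := by positivity
    refine le_of_mul_le_mul_right ?_ hzw
    calc N * z ^ w ≤ ρ ^ m / (1 - p) ^ n := h1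
      _ = ρ ^ m * (H * z ^ w) := by rw [hd]; ring
      _ = _ := by ring
  have hNW : N / W ≤ (n + 1) * ρ ^ m := by
    rw [div_le_iff₀ hWpos]
    calc N ≤ H * ρ ^ m := hNH
      _ ≤ ((n + 1) * W) * ρ ^ m := by gcongr
      _ = _ := by ring
  calc W * (N / W) ^ t ≤ H * ((n + 1) * ρ ^ m) ^ t := by gcongr
    _ = _ := by rw [mul_pow, ← pow_mul]; ring

/-- The expected number of codewords of weight `w` when `w` is small compared with `n / s`. -/
theorem first_moment_sparse {q n w s m t : ℕ} {N : ℝ} (hq : 2 ≤ q) (hw0 : 0 < w)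
    (hn : n = m * s) (hN0 : 0 ≤ N) (ht : 4 ≤ t)
    (hN : ∀ z : ℝ, 0 ≤ z → z ≤ 1 →
      N * z ^ w ≤ (((1 + ((q : ℝ) - 1) * z) ^ s + ((q : ℝ) - 1) * (1 - z) ^ s) / q) ^ m)
    (hn0 : 0 < n) (hwn : w ≤ n) (hws : (w : ℝ) * s / n ≤ 1 / (4 * Real.exp 1 ^ 2))
    (hst : (s : ℝ) * (q - 1) * Real.exp 1 ^ 4 * (1 / 2) ^ (t - 4) ≤ 1 / 2) :
    (n.choose w * ((q : ℝ) - 1) ^ w) * (N / (n.choose w * ((q : ℝ) - 1) ^ w)) ^ t ≤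
      ((w : ℝ) * s / n / 2) ^ w := by
  have hq2 : (2 : ℝ) ≤ q := by exact_mod_cast hq
  have hq' : (0 : ℝ) < (q : ℝ) - 1 := by linarith
  have hn' : (0 : ℝ) < n := by exact_mod_cast hn0
  have hw' : (0 : ℝ) < w := by exact_mod_cast hw0
  have hm0 : 0 < m := Nat.pos_of_ne_zero (by rintro rfl; omega)
  have hs0 : 0 < s := Nat.pos_of_ne_zero (by rintro rfl; omega)
  have hs' : (0 : ℝ) < s := by exact_mod_cast hs0
  have hs1 : (1 : ℝ) ≤ s := by exact_mod_cast hs0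
  have hms : (n : ℝ) = m * s := by exact_mod_cast hn
  set e := Real.exp 1 with he
  have he1 : 1 ≤ e := Real.one_le_exp (by norm_num)
  have he0 : 0 < e := Real.exp_pos _
  set u : ℝ := Real.sqrt ((w : ℝ) * s / n) with hu
  have hu2 : u ^ 2 = (w : ℝ) * s / n := Real.sq_sqrt (by positivity)
  have hu0 : 0 < u := Real.sqrt_pos.2 (by positivity)
  have heu : e * u ≤ 1 / 2 := by
    have h : (e * u) ^ 2 ≤ (1 / 2) ^ 2 := by
      rw [mul_pow, hu2]
      calc e ^ 2 * ((w : ℝ) * s / n) ≤ e ^ 2 * (1 / (4 * e ^ 2)) := by gcongr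
        _ = (1 / 2) ^ 2 := by field_simp; norm_num
    exact le_of_sq_le_sq h (by norm_num)
  have hu1 : u ≤ 1 := by nlinarith
  set W : ℝ := n.choose w * ((q : ℝ) - 1) ^ w with hW
  have hWle : ((s : ℝ) * (q - 1) / u ^ 2) ^ w ≤ W := by
    have h := pow_div_le_choose hwn
    have e1 : (s : ℝ) * (q - 1) / u ^ 2 = (n : ℝ) / w * (q - 1) := by
      rw [hu2]; field_simp
    rw [e1, mul_pow, hW]
    gcongr
  have hWpos : 0 < W := lt_of_lt_of_le (by positivity) hWle
  have hNle : N ≤ (e * (s * (q - 1)) / u) ^ w := by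
    set z : ℝ := u / (s * (q - 1)) with hz
    have hz0 : 0 < z := by positivity
    have hz1 : z ≤ 1 := by
      rw [hz, div_le_one (by positivity)]; nlinarith
    have h1 := hN z hz0.le hz1
    have ha : (1 + ((q : ℝ) - 1) * z) ^ s ≤ Real.exp u := by
      calc (1 + ((q : ℝ) - 1) * z) ^ s ≤ (Real.exp (((q : ℝ) - 1) * z)) ^ s := by
            gcongr
            rw [add_comm]; exact Real.add_one_le_exp _
        _ = Real.exp u := by
            rw [← Real.exp_nat_mul]; congr 1; rw [hz]; field_simp
    have hb : (1 - z) ^ s ≤ Real.exp (-(u / (q - 1))) := by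
      calc (1 - z) ^ s ≤ (Real.exp (-z)) ^ s := by
            have : 0 ≤ 1 - z := by linarith
            gcongr
            exact Real.one_sub_le_exp_neg z
        _ = Real.exp (-(u / (q - 1))) := by
            rw [← Real.exp_nat_mul]; congr 1; rw [hz]; field_simp
    have hexp : ∀ x : ℝ, |x| ≤ 1 → Real.exp x ≤ 1 + x + x ^ 2 := by
      intro x hx
      have := (abs_le.1 (Real.abs_exp_sub_one_sub_id_le hx)).2
      linarith
    have ha' := hexp u (by rwa [abs_of_pos hu0])
    have huq : u / ((q : ℝ) - 1) ≤ u := div_le_self hu0.le (by linarith)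
    have hb' := hexp (-(u / (q - 1))) (by
      rw [abs_neg, abs_of_pos (by positivity)]; linarith)
    have hg : ((1 + ((q : ℝ) - 1) * z) ^ s + ((q : ℝ) - 1) * (1 - z) ^ s) / q ≤
        Real.exp (u ^ 2) := by
      refine le_trans ?_ (Real.add_one_le_exp _)
      rw [div_le_iff₀ (by positivity)]
      have h2 : ((q : ℝ) - 1) * (1 - z) ^ s ≤
          (q - 1) * (1 + -(u / (q - 1)) + (-(u / (q - 1))) ^ 2) := by
        gcongr; exact hb.trans hb'
      have h3 : ((q : ℝ) - 1) * (1 + -(u / (q - 1)) + (-(u / (q - 1))) ^ 2) =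
          (q - 1) - u + u * (u / (q - 1)) := by field_simp; ring
      have h4 : u * (u / (q - 1)) ≤ u * u := by gcongr
      nlinarith [sq_nonneg u]
    have h5 : N * z ^ w ≤ e ^ w := by
      refine h1.trans ?_
      have hge : 0 ≤ ((1 + ((q : ℝ) - 1) * z) ^ s + ((q : ℝ) - 1) * (1 - z) ^ s) / q := by
        have : 0 ≤ 1 - z := by linarith
        positivity
      refine (pow_le_pow_left₀ hge hg m).trans (le_of_eq ?_)
      rw [← Real.exp_nat_mul, he, ← Real.exp_nat_mul, hu2, hms]
      congr 1
      field_simp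
    have hzw : 0 < z ^ w := by positivity
    refine le_of_mul_le_mul_right (h5.trans (le_of_eq ?_)) hzw
    rw [← mul_pow, hz]
    congr 1
    field_simp
  have hNW : N / W ≤ (e * u) ^ w := by
    rw [div_le_iff₀ hWpos]
    refine hNle.trans ?_
    calc (e * (s * (q - 1)) / u) ^ w = (e * u) ^ w * ((s : ℝ) * (q - 1) / u ^ 2) ^ w := by
          rw [← mul_pow]; congr 1; field_simp
      _ ≤ (e * u) ^ w * W := by gcongr
  obtain ⟨k, rfl⟩ : ∃ k, t = k + 4 := ⟨t - 4, by omega⟩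
  rw [Nat.add_sub_cancel] at hst
  have hsplit : W * (N / W) ^ (k + 4) = N * (N / W) ^ (k + 3) := by
    rw [show k + 4 = (k + 3) + 1 by ring, pow_succ]; field_simp
  have hNW0 : 0 ≤ N / W := by positivity
  rw [hsplit]
  calc N * (N / W) ^ (k + 3)
      ≤ (e * (s * (q - 1)) / u) ^ w * ((e * u) ^ w) ^ (k + 3) := by gcongr
    _ = (u ^ 2 * (s * (q - 1) * e ^ 4 * (e * u) ^ k)) ^ w := by
        rw [← pow_mul, mul_comm w (k + 3), pow_mul, ← mul_pow]
        congr 1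
        field_simp
        ring
    _ ≤ (u ^ 2 * (1 / 2)) ^ w := by
        gcongr
        refine le_trans ?_ hst
        gcongr
    _ = _ := by rw [hu2]; congr 1; ring

end FirstMoment

section Asymptotics

theorem qEntropy_eq (q : ℕ) (x : ℝ) : qEntropy q x = Real.qaryEntropy q x / Real.log q := by
  simp only [qEntropy, Real.qaryEntropy, Real.binEntropy, Real.logb, Real.log_inv]
  push_cast
  ring

open Filter Topology in
/-- For large `s`, the exponent of the expected number of codewords of weight `p * n` is bounded
away from zero, uniformly in `p ≥ a / s`. -/
theorem exists_exponent_gap {q : ℕ} (hq : 2 ≤ q) {δ ε a θ : ℝ} (hδ0 : 0 < δ)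
    (hδ1 : δ < 1 - 1 / q) (hε : 0 < ε) (ha : 0 < a)
    (hθ : θ = Real.qaryEntropy q δ / Real.log q + ε) :
    ∃ γ : ℝ, 0 < γ ∧ ∀ᶠ s : ℕ in atTop, ∀ p : ℝ, 0 < p → p ≤ δ → a ≤ p * s →
      Real.qaryEntropy q p +
        θ * Real.log ((1 + ((q : ℝ) - 1) * (1 - q / ((q : ℝ) - 1) * p) ^ s) / q) ≤ -γ := by
  have hq2 : (2 : ℝ) ≤ q := by exact_mod_cast hq
  have hq' : (0 : ℝ) < (q : ℝ) - 1 := by linarith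
  have hq0 : (0 : ℝ) < q := by linarith
  have hlog : 0 < Real.log q := Real.log_pos (by linarith)
  have hinv : 0 < 1 / (q : ℝ) := by positivity
  have hδpos : 0 < Real.qaryEntropy q δ := Real.qaryEntropy_pos hδ0 (by linarith)
  have hθ0 : 0 < θ := by rw [hθ]; positivity
  have hθlog : θ * Real.log q = Real.qaryEntropy q δ + ε * Real.log q := by
    rw [hθ]; field_simp
  have hmono := (Real.qaryEntropy_strictMonoOn hq).monotoneOn
  set L : ℝ → ℝ := fun x => Real.log ((1 + ((q : ℝ) - 1) * Real.exp (-x)) / q) with hL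
  have hLle : ∀ x : ℝ, ∀ p : ℝ, ∀ s : ℕ, 0 < p → p ≤ δ → x ≤ p * s →
      Real.log ((1 + ((q : ℝ) - 1) * (1 - q / ((q : ℝ) - 1) * p) ^ s) / q) ≤ L x := by
    intro x p s hp0 hpδ hx
    have h0 : 0 ≤ 1 - q / ((q : ℝ) - 1) * p := by
      have h1 : (q : ℝ) * p ≤ q * (1 - 1 / q) := by gcongr; linarith
      rw [mul_sub, mul_one, mul_one_div_cancel hq0.ne'] at h1
      have : q / ((q : ℝ) - 1) * p ≤ 1 := by
        rw [div_mul_eq_mul_div, div_le_one hq']; exact h1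
      linarith
    have h1 : 1 - q / ((q : ℝ) - 1) * p ≤ Real.exp (-p) := by
      have : 1 ≤ q / ((q : ℝ) - 1) := by rw [le_div_iff₀ hq']; linarith
      have h2 := Real.one_sub_le_exp_neg p
      nlinarith
    have h2 : (1 - q / ((q : ℝ) - 1) * p) ^ s ≤ Real.exp (-x) := by
      calc (1 - q / ((q : ℝ) - 1) * p) ^ s ≤ Real.exp (-p) ^ s := by gcongr
        _ = Real.exp (-(p * s)) := by rw [← Real.exp_nat_mul]; congr 1; ring
        _ ≤ Real.exp (-x) := by gcongr
    have h3 : 0 ≤ (1 - q / ((q : ℝ) - 1) * p) ^ s := by positivity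
    refine Real.log_le_log (by positivity) ?_
    gcongr
  have hκ : 0 < -L a := by
    rw [hL, neg_pos]
    refine Real.log_neg (by positivity) ?_
    rw [div_lt_one hq0]
    have : Real.exp (-a) < 1 := Real.exp_lt_one_iff.2 (by linarith)
    nlinarith
  obtain ⟨p₀, hp₀, hp₀δ, hp₀e⟩ : ∃ p₀ : ℝ, 0 < p₀ ∧ p₀ ≤ δ ∧
      Real.qaryEntropy q p₀ ≤ θ * (-L a) / 2 := by
    have hc : Tendsto (Real.qaryEntropy q) (𝓝[>] 0) (𝓝 0) := by
      have := (Real.qaryEntropy_continuous (q := q)).tendsto 0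
      rw [Real.qaryEntropy_zero] at this
      exact this.mono_left nhdsWithin_le_nhds
    have h1 := hc.eventually_le_const (show (0 : ℝ) < θ * (-L a) / 2 by positivity)
    have h2 : ∀ᶠ p : ℝ in 𝓝[>] 0, p ∈ Set.Ioo 0 δ := Ioo_mem_nhdsGT hδ0
    obtain ⟨p, hp1, hp2⟩ := (h1.and h2).exists
    exact ⟨p, hp2.1, hp2.2.le, hp1⟩
  have hlim : Tendsto (fun s : ℕ => L (p₀ * s)) atTop (𝓝 (-Real.log q)) := by
    have h1 : Tendsto (fun s : ℕ => Real.exp (-(p₀ * s))) atTop (𝓝 0) :=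
      Real.tendsto_exp_neg_atTop_nhds_zero.comp
        (tendsto_natCast_atTop_atTop.const_mul_atTop hp₀)
    have h2 : Tendsto (fun s : ℕ => (1 + ((q : ℝ) - 1) * Real.exp (-(p₀ * s))) / q) atTop
        (𝓝 ((1 + ((q : ℝ) - 1) * 0) / q)) := ((h1.const_mul _).const_add _).div_const _
    rw [mul_zero, add_zero, one_div] at h2
    have := h2.log (by positivity)
    rwa [Real.log_inv] at this
  have hev : ∀ᶠ s : ℕ in atTop, L (p₀ * s) ≤ -Real.log q + ε * Real.log q / (2 * θ) :=
    hlim.eventually_le_const (by rw [lt_add_iff_pos_right]; positivity)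
  refine ⟨min (θ * (-L a) / 2) (ε * Real.log q / 2), by positivity, ?_⟩
  filter_upwards [hev] with s hs p hp0 hpδ hps
  rcases le_total p p₀ with h | h
  · have h1 : Real.qaryEntropy q p ≤ Real.qaryEntropy q p₀ :=
      hmono ⟨hp0.le, by linarith⟩ ⟨hp₀.le, by linarith⟩ h
    have h2 := mul_le_mul_of_nonneg_left (hLle a p s hp0 hpδ hps) hθ0.le
    have h3 := min_le_left (θ * (-L a) / 2) (ε * Real.log q / 2)
    linarith
  · have h1 : Real.qaryEntropy q p ≤ Real.qaryEntropy q δ :=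
      hmono ⟨hp0.le, by linarith⟩ ⟨hδ0.le, by linarith⟩ hpδ
    have h2 := mul_le_mul_of_nonneg_left
      ((hLle (p₀ * s) p s hp0 hpδ (by gcongr)).trans hs) hθ0.le
    have h3 := min_le_right (θ * (-L a) / 2) (ε * Real.log q / 2)
    have h4 : θ * (-Real.log q + ε * Real.log q / (2 * θ)) =
        -(θ * Real.log q) + ε * Real.log q / 2 := by field_simp
    rw [h4, hθlog] at h2
    linarith

open Filter Topology in
theorem eventually_four_le_and_mul_half_pow_le {θ : ℝ} (hθ : 0 < θ) (C : ℝ) (hC : 0 ≤ C) :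
    ∀ᶠ s : ℕ in atTop, ∀ t : ℕ, θ * s ≤ t →
      4 ≤ t ∧ (s : ℝ) * C * (1 / 2) ^ (t - 4) ≤ 1 / 2 := by
  have h4 : ∀ᶠ s : ℕ in atTop, (4 : ℝ) ≤ θ * s :=
    (tendsto_natCast_atTop_atTop.const_mul_atTop hθ).eventually_ge_atTop 4
  have hlim : Tendsto (fun s : ℕ => 16 * C * ((s : ℝ) * ((1 / 2 : ℝ) ^ θ) ^ s)) atTop
      (𝓝 (16 * C * 0)) :=
    (tendsto_self_mul_const_pow_of_lt_one (by positivity)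
      (Real.rpow_lt_one (by norm_num) (by norm_num) hθ)).const_mul _
  rw [mul_zero] at hlim
  filter_upwards [h4, hlim.eventually_le_const (show (0 : ℝ) < 1 / 2 by norm_num)] with s hs hs' t ht
  have ht4 : 4 ≤ t := by exact_mod_cast hs.trans ht
  refine ⟨ht4, le_trans ?_ hs'⟩
  obtain ⟨k, rfl⟩ : ∃ k, t = k + 4 := ⟨t - 4, by omega⟩
  have h1 : (1 / 2 : ℝ) ^ (k + 4) ≤ ((1 / 2 : ℝ) ^ θ) ^ s := by
    rw [← Real.rpow_mul_natCast (by norm_num), ← Real.rpow_natCast]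
    exact Real.rpow_le_rpow_of_exponent_ge (by norm_num) (by norm_num) ht
  have h2 : (1 / 2 : ℝ) ^ k ≤ 16 * ((1 / 2 : ℝ) ^ θ) ^ s := by
    rw [pow_add] at h1; linarith
  rw [Nat.add_sub_cancel]
  calc (s : ℝ) * C * (1 / 2) ^ k ≤ s * C * (16 * ((1 / 2 : ℝ) ^ θ) ^ s) := by gcongr
    _ = _ := by ring

open Filter Topology in
theorem tendsto_failure_bound (s k : ℕ) {γ : ℝ} (hγ : 0 < γ) :
    Tendsto (fun n : ℕ => 2 * ((s : ℝ) / n) + ((n : ℝ) + 1) ^ k * Real.exp (-γ * n)) atTop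
      (𝓝 0) := by
  have h1 : Tendsto (fun n : ℕ => 2 * ((s : ℝ) / n)) atTop (𝓝 (2 * 0)) :=
    (tendsto_const_div_atTop_nhds_zero_nat _).const_mul _
  have h2 := (tendsto_pow_const_mul_const_pow_of_lt_one k (Real.exp_pos (-γ)).le
    (Real.exp_lt_one_iff.2 (by linarith))).comp (tendsto_add_atTop_nat 1)
  have h3 := h1.add (h2.mul_const (Real.exp γ))
  rw [mul_zero, zero_mul, add_zero] at h3
  refine h3.congr fun n => ?_
  simp only [Function.comp_apply]
  rw [mul_assoc, ← Real.exp_nat_mul, ← Real.exp_add]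
  push_cast
  congr 3
  ring

theorem sum_mul_half_pow_le (n : ℕ) :
    ∑ w ∈ Finset.range n, (w : ℝ) * (1 / 2) ^ w ≤ 2 := by
  have h := hasSum_coe_mul_geometric_of_norm_lt_one (r := (1 / 2 : ℝ)) (by norm_num)
  refine (sum_le_hasSum _ (fun i _ => by positivity) h).trans (by norm_num)

/-- Rewrite the dense first-moment bound through its exponent. -/
theorem succ_pow_mul_exp_mul_pow_le {q n s m t : ℕ} {p θ γ : ℝ} (hq : 2 ≤ q) (hp0 : 0 ≤ p)
    (hp1 : p < 1 - 1 / q) (hmt : θ * n ≤ ((m * t : ℕ) : ℝ))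
    (hg : Real.qaryEntropy q p +
      θ * Real.log ((1 + ((q : ℝ) - 1) * (1 - q / ((q : ℝ) - 1) * p) ^ s) / q) ≤ -γ) :
    (n + 1 : ℝ) ^ t * Real.exp (n * Real.qaryEntropy q p) *
        ((1 + ((q : ℝ) - 1) * (1 - q / ((q : ℝ) - 1) * p) ^ s) / q) ^ (m * t) ≤
      ((n : ℝ) + 1) ^ t * Real.exp (-γ * n) := by
  have hq2 : (2 : ℝ) ≤ q := by exact_mod_cast hq
  have hq' : (0 : ℝ) < (q : ℝ) - 1 := by linarith
  set ρ : ℝ := (1 + ((q : ℝ) - 1) * (1 - q / ((q : ℝ) - 1) * p) ^ s) / q with hρ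
  have hη0 : 0 ≤ 1 - q / ((q : ℝ) - 1) * p := by
    have h1 : (q : ℝ) * p ≤ q * (1 - 1 / q) := by gcongr
    rw [mul_sub, mul_one, mul_one_div_cancel (by positivity)] at h1
    have : q / ((q : ℝ) - 1) * p ≤ 1 := by
      rw [div_mul_eq_mul_div, div_le_one hq']; exact h1
    linarith
  have hη1 : 1 - q / ((q : ℝ) - 1) * p ≤ 1 := by
    rw [sub_le_self_iff]; positivity
  have hρ0 : 0 < ρ := by positivity
  have hρ1 : ρ ≤ 1 := by
    rw [hρ, div_le_one (by positivity)]
    have := pow_le_one₀ (n := s) hη0 hη1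
    nlinarith
  have hpow : ρ ^ (m * t) ≤ Real.exp (n * (θ * Real.log ρ)) := by
    rw [← Real.rpow_natCast, Real.rpow_def_of_pos hρ0]
    refine Real.exp_le_exp.2 ?_
    have := mul_le_mul_of_nonpos_right hmt (Real.log_nonpos hρ0.le hρ1)
    linarith
  calc (n + 1 : ℝ) ^ t * Real.exp (n * Real.qaryEntropy q p) * ρ ^ (m * t)
      ≤ (n + 1 : ℝ) ^ t * Real.exp (n * Real.qaryEntropy q p) *
          Real.exp (n * (θ * Real.log ρ)) := by gcongr
    _ = (n + 1 : ℝ) ^ t * Real.exp (n * (Real.qaryEntropy q p + θ * Real.log ρ)) := by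
        rw [mul_assoc, ← Real.exp_add, mul_add]
    _ ≤ (n + 1 : ℝ) ^ t * Real.exp (n * -γ) := by gcongr
    _ = _ := by rw [mul_comm (n : ℝ)]

end Asymptotics

open Classical in
theorem card_blockKernel_mul_pow_le {F : Type} [Field F] [Fintype F] [DecidableEq F]
    (m s w : ℕ) (hs : 0 < s) {z : ℝ} (hz : 0 ≤ z) :
    ((Finset.univ.filter fun y : Fin (m * s) → F =>
        hammingNorm y = w ∧ y ∈ blockKernel F (m * s) s).card : ℝ) * z ^ w ≤
      (((1 + ((Fintype.card F : ℝ) - 1) * z) ^ s +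
        ((Fintype.card F : ℝ) - 1) * (1 - z) ^ s) / Fintype.card F) ^ m := by
  rw [← sum_pow_hammingNorm_blockKernel z m s hs, ← nsmul_eq_mul, ← Finset.sum_const,
    Finset.sum_filter]
  refine Finset.sum_le_sum fun y _ => ?_
  by_cases h : y ∈ blockKernel F (m * s) s
  · by_cases hw : hammingNorm y = w
    · simp [h, hw]
    · simp only [h, hw, false_and, if_false, if_true]; positivity
  · simp [h]

/-- Random `s`-LDPC codes achieve the Gilbert–Varshamov bound: for any
`δ ∈ (0, 1 - 1/q)`, `ε > 0` and large enough `s`, a random `s`-LDPC code of any rate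
`R ≤ 1 - h_q(δ) - ε` has relative distance at least `δ` with high probability. -/
theorem ldpc_achieves_gv_bound
    (q : ℕ) (F : Type) [Field F] [Fintype F] [DecidableEq F]
    (hcard : Fintype.card F = q)
    (δ ε : ℝ) (hδ : δ ∈ Set.Ioo (0 : ℝ) (1 - 1 / q)) (hε : 0 < ε) :
    ∃ s₀ : ℕ, 1 ≤ s₀ ∧ ∀ s : ℕ, s₀ ≤ s →
      ∀ R : ℝ, R ≤ 1 - qEntropy q δ - ε →
        ∀ ε' : ℝ, 0 < ε' → ∃ N : ℕ, ∀ n : ℕ, N ≤ n → s ∣ n →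
          ∀ t : ℕ, (t : ℝ) = (1 - R) * s →
            1 - ε' ≤ ldpcProb F n s t
              (fun C => ∀ x ∈ C, x ≠ 0 → δ ≤ relWt x) := by
  classical
  subst hcard
  obtain ⟨hδ0, hδ1⟩ := hδ
  set q := Fintype.card F with hqdef
  have hq : 2 ≤ q := Fintype.one_lt_card
  have hq2 : (2 : ℝ) ≤ q := by exact_mod_cast hq
  have hq' : (0 : ℝ) < (q : ℝ) - 1 := by linarith
  have hinv : 0 < 1 / (q : ℝ) := by positivity
  have hlog : 0 < Real.log q := Real.log_pos (by linarith)
  obtain ⟨θ, hθ⟩ : ∃ θ, θ = Real.qaryEntropy q δ / Real.log q + ε := ⟨_, rfl⟩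
  have hθ0 : 0 < θ := by
    have : 0 < Real.qaryEntropy q δ := Real.qaryEntropy_pos hδ0 (by linarith)
    rw [hθ]; positivity
  have ha : 0 < 1 / (4 * Real.exp 1 ^ 2) := by positivity
  have ha1 : 1 / (4 * Real.exp 1 ^ 2) ≤ 1 := by
    have : 1 ≤ Real.exp 1 := Real.one_le_exp (by norm_num)
    rw [div_le_one (by positivity)]; nlinarith
  obtain ⟨γ, hγ, hgap⟩ := exists_exponent_gap hq hδ0 hδ1 hε ha hθ
  have hsp := eventually_four_le_and_mul_half_pow_le hθ0 (((q : ℝ) - 1) * Real.exp 1 ^ 4)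
    (by positivity)
  obtain ⟨s₀, hs₀⟩ := Filter.eventually_atTop.1 (hgap.and hsp)
  refine ⟨max 1 s₀, le_max_left _ _, fun s hs R hR ε' hε' => ?_⟩
  have hs1 : 0 < s := (le_max_left 1 s₀).trans hs
  have hs' : (0 : ℝ) < s := by exact_mod_cast hs1
  obtain ⟨hgap, hsp⟩ := hs₀ s ((le_max_right 1 s₀).trans hs)
  obtain ⟨N, hN⟩ := Filter.eventually_atTop.1
    ((tendsto_failure_bound s (⌊(1 - R) * s⌋₊ + 1) hγ).eventually_le_const hε')
  refine ⟨max 1 N, fun n hn hsn t ht => ?_⟩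
  have hbound := hN n ((le_max_right 1 N).trans hn)
  rw [← ht, Nat.floor_natCast] at hbound
  have hn0 : 0 < n := (le_max_left 1 N).trans hn
  have hn' : (0 : ℝ) < n := by exact_mod_cast hn0
  obtain ⟨m, hm⟩ : ∃ m, n = m * s := by
    obtain ⟨m, hm⟩ := hsn
    exact ⟨m, hm.trans (mul_comm s m)⟩
  have hms : (n : ℝ) = m * s := by exact_mod_cast hm
  have hθt : θ * s ≤ t := by
    rw [ht]
    rw [qEntropy_eq] at hR
    gcongr
    linarith
  obtain ⟨ht4, hst⟩ := hsp t hθt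
  refine le_trans (sub_le_sub_left ?_ 1) (one_sub_sum_le_ldpcProb n s t δ hn0)
  refine le_trans ?_ hbound
  have hterm : ∀ w ∈ (Finset.range (n + 1)).filter (fun w : ℕ => 0 < w ∧ (w : ℝ) < δ * n),
      ((n.choose w * (Fintype.card F - 1) ^ w : ℕ) : ℝ) *
          ((Finset.univ.filter fun y : Fin n → F =>
              hammingNorm y = w ∧ y ∈ blockKernel F n s).card /
            ((n.choose w * (Fintype.card F - 1) ^ w : ℕ) : ℝ)) ^ t ≤
        (s : ℝ) / n * (w * (1 / 2) ^ w) + ((n : ℝ) + 1) ^ t * Real.exp (-γ * n) := by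
    intro w hw
    rw [Finset.mem_filter, Finset.mem_range] at hw
    obtain ⟨hwn, hw0, hwδ⟩ := hw
    have hw' : (0 : ℝ) < w := by exact_mod_cast hw0
    have hW : ((n.choose w * (Fintype.card F - 1) ^ w : ℕ) : ℝ) =
        n.choose w * ((q : ℝ) - 1) ^ w := by
      rw [← hqdef]
      push_cast [Nat.cast_sub (show 1 ≤ q by omega)]
      rfl
    have hNz : ∀ z : ℝ, 0 ≤ z → z ≤ 1 →
        ((Finset.univ.filter fun y : Fin n → F =>
          hammingNorm y = w ∧ y ∈ blockKernel F n s).card : ℝ) * z ^ w ≤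
        (((1 + ((q : ℝ) - 1) * z) ^ s + ((q : ℝ) - 1) * (1 - z) ^ s) / q) ^ m := by
      intro z hz _
      subst hm
      exact card_blockKernel_mul_pow_le m s w hs1 hz
    rw [hW]
    rcases le_total ((w : ℝ) * s / n) (1 / (4 * Real.exp 1 ^ 2)) with h | h
    · refine (first_moment_sparse hq hw0 hm (Nat.cast_nonneg _) ht4 hNz hn0 (by omega) h
        (by rwa [mul_assoc (s : ℝ)])).trans ?_
      have hx0 : 0 ≤ (w : ℝ) * s / n := by positivity
      have h1 : ((w : ℝ) * s / n) ^ w ≤ (w : ℝ) * s / n :=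
        pow_le_of_le_one hx0 (h.trans ha1) hw0.ne'
      have h2 : ((w : ℝ) * s / n / 2) ^ w ≤ (s : ℝ) / n * (w * (1 / 2) ^ w) := by
        calc ((w : ℝ) * s / n / 2) ^ w = ((w : ℝ) * s / n) ^ w * (1 / 2) ^ w := by
              rw [← mul_pow]; congr 1; ring
          _ ≤ ((w : ℝ) * s / n) * (1 / 2) ^ w := by gcongr
          _ = _ := by ring
      have h3 : 0 ≤ ((n : ℝ) + 1) ^ t * Real.exp (-γ * n) := by positivity
      linarith
    · have hpδ : (w : ℝ) / n < δ := by rwa [div_lt_iff₀ hn']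
      refine (first_moment_dense hq hw0 hm (hpδ.trans hδ1) (Nat.cast_nonneg _) hNz hn0).trans ?_
      have hg := hgap ((w : ℝ) / n) (by positivity) hpδ.le (by rwa [div_mul_eq_mul_div])
      have hmt : θ * n ≤ ((m * t : ℕ) : ℝ) := by
        rw [hms]
        push_cast
        nlinarith [mul_le_mul_of_nonneg_left hθt (Nat.cast_nonneg (α := ℝ) m)]
      have h1 : 0 ≤ (s : ℝ) / n * (w * (1 / 2) ^ w) := by positivity
      have h2 := succ_pow_mul_exp_mul_pow_le hq (by positivity) (hpδ.trans hδ1) hmt hg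
      linarith
  refine (Finset.sum_le_sum hterm).trans ?_
  refine (Finset.sum_le_sum_of_subset_of_nonneg (Finset.filter_subset _ _)
    fun w _ _ => by positivity).trans ?_
  rw [Finset.sum_add_distrib, ← Finset.mul_sum, Finset.sum_const, Finset.card_range, nsmul_eq_mul]
  refine add_le_add ?_ (le_of_eq ?_)
  · rw [mul_comm (2 : ℝ)]
    gcongr
    exact sum_mul_half_pow_le _
  · push_cast; ring
end

section
/- Fix a prime power q and an integer s ≥ 3. The function λ ↦ φ(λ)/h_q(λ) is strictly increasing on the interval (0, (q−1)/q]. -/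
open Finset

/-- `Z(β) = (1 + (q−1)(1 − qβ/(q−1))^s)/q`, the probability that `s` i.i.d. samples from
`μ_q(β)` sum to zero. -/
noncomputable def Zfun (q s : ℕ) (β : ℝ) : ℝ :=
  (1 + ((q : ℝ) - 1) * (1 - (q : ℝ) * β / ((q : ℝ) - 1)) ^ s) / q

/-- The base-`q` KL divergence `D_q(λ‖β)`. -/
noncomputable def klDiv (q : ℕ) (lam β : ℝ) : ℝ :=
  lam * Real.logb q (lam / β) + (1 - lam) * Real.logb q ((1 - lam) / (1 - β))

/-- `ψ(λ,β) = s·D_q(λ‖β) + log_q Z(β)`. -/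
noncomputable def psiFun (q s : ℕ) (lam β : ℝ) : ℝ :=
  (s : ℝ) * klDiv q lam β + Real.logb q (Zfun q s β)

/-- `φ(λ) = inf_{β ∈ (0,(q−1)/q]} ψ(λ,β)`. -/
noncomputable def phiFun (q s : ℕ) (lam : ℝ) : ℝ :=
  sInf (psiFun q s lam '' Set.Ioc 0 (((q : ℝ) - 1) / q))

/-- The sequence `M` is recovered from its second differences, weighted by the index. -/
theorem sum_index_mul_secondDiff (M : ℕ → ℝ) (h0 : M 0 = 0) (h1 : M 1 = 0) (m : ℕ) :
    ∑ i ∈ range m, ((i : ℝ) + 1) * (M (i + 2) - 2 * M (i + 1) + M i) =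
      m * M (m + 1) - (m + 1) * M m := by
  induction m with
  | zero => simp [h0, h1]
  | succ m ih => rw [sum_range_succ, ih]; push_cast; ring

theorem sum_secondDiff (M : ℕ → ℝ) (h0 : M 0 = 0) (h1 : M 1 = 0) (m : ℕ) :
    ∑ i ∈ range m, (M (i + 2) - 2 * M (i + 1) + M i) = M (m + 1) - M m := by
  induction m with
  | zero => simp [h0, h1]
  | succ m ih => rw [sum_range_succ, ih]; ring

theorem sum_reverse_index_mul_secondDiff (M : ℕ → ℝ) (h0 : M 0 = 0) (h1 : M 1 = 0) (m : ℕ) :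
    ∑ i ∈ range m, ((m : ℝ) - i) * (M (i + 2) - 2 * M (i + 1) + M i) = M (m + 1) := by
  have hA := sum_index_mul_secondDiff M h0 h1 m
  have hB := sum_secondDiff M h0 h1 m
  have : ∀ i ∈ range m, ((m : ℝ) - i) * (M (i + 2) - 2 * M (i + 1) + M i) =
      (m + 1) * (M (i + 2) - 2 * M (i + 1) + M i) -
        ((i : ℝ) + 1) * (M (i + 2) - 2 * M (i + 1) + M i) := fun i _ => by ring
  rw [sum_congr rfl this, sum_sub_distrib, ← mul_sum, hA, hB]
  ring

theorem weighted_pair_pos {a b u v r : ℝ} (ha : 0 < a) (hab : a ≤ b) (hu : 0 < u)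
    (hr : 0 ≤ r) (hr1 : r < 1) (h : r * u ≤ v) :
    0 < a * u + b * v - r * (b * u + a * v) := by
  have h1 : 0 < b - a * r := by nlinarith
  have h2 : 0 ≤ (b - a * r) * (v - r * u) := mul_nonneg h1.le (by linarith)
  have h3 : 0 < a * u * (1 - r * r) := mul_pos (mul_pos ha hu) (by nlinarith)
  nlinarith

/-- If the second differences of `M` are positive and their reflection about the midpoint loses
at most a factor `r < 1`, then `M (m + 1) / M m` is bounded below. -/
theorem mul_lt_of_secondDiff_reflect (M : ℕ → ℝ) (h0 : M 0 = 0) (h1 : M 1 = 0) {m : ℕ}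
    (hm : 0 < m) {r : ℝ} (hr : 0 ≤ r) (hr1 : r < 1)
    (hpos : ∀ i, 0 < M (i + 2) - 2 * M (i + 1) + M i)
    (hrefl : ∀ i j, i ≤ j → i + j + 1 = m →
      r * (M (i + 2) - 2 * M (i + 1) + M i) ≤ M (j + 2) - 2 * M (j + 1) + M j) :
    (m + 1) * M m < (m - r) * M (m + 1) := by
  have hA := sum_index_mul_secondDiff M h0 h1 m
  have hB := sum_reverse_index_mul_secondDiff M h0 h1 m
  set d : ℕ → ℝ := fun i => M (i + 2) - 2 * M (i + 1) + M i with hd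
  change ∀ i, 0 < d i at hpos
  change ∀ i j, i ≤ j → i + j + 1 = m → r * d i ≤ d j at hrefl
  change ∑ i ∈ range m, ((i : ℝ) + 1) * d i = _ at hA
  change ∑ i ∈ range m, ((m : ℝ) - i) * d i = _ at hB
  have hA' := hA
  have hB' := hB
  rw [← sum_range_reflect] at hA' hB'
  have key : 0 < ∑ i ∈ range m, ((((i : ℝ) + 1) * d i - r * (((m : ℝ) - i) * d i)) +
      ((((m - 1 - i : ℕ) : ℝ) + 1) * d (m - 1 - i) -
        r * (((m : ℝ) - (m - 1 - i : ℕ)) * d (m - 1 - i)))) := by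
    apply sum_pos
    · intro i hi
      rw [Finset.mem_range] at hi
      obtain ⟨j, rfl⟩ : ∃ j, m = i + j + 1 := ⟨m - 1 - i, by omega⟩
      have hj : i + j + 1 - 1 - i = j := by omega
      rw [hj]
      push_cast
      rcases le_total i j with hij | hij
      · have hij' : (i : ℝ) ≤ j := by exact_mod_cast hij
        have := weighted_pair_pos (a := (i : ℝ) + 1) (b := (j : ℝ) + 1) (by positivity)
          (by linarith) (hpos i) hr hr1 (hrefl i j hij rfl)
        linarith
      · have hij' : (j : ℝ) ≤ i := by exact_mod_cast hij
        have := weighted_pair_pos (a := (j : ℝ) + 1) (b := (i : ℝ) + 1) (by positivity)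
          (by linarith) (hpos j) hr hr1 (hrefl j i hij (by omega))
        linarith
    · exact ⟨0, Finset.mem_range.2 hm⟩
  rw [sum_add_distrib, sum_sub_distrib, sum_sub_distrib, ← mul_sum, ← mul_sum, hA, hB, hA',
    hB'] at key
  linarith

/-- Minus the logarithm of the Krawtchouk-type involution `x ↦ (1 - x) / (1 + Q x)`. -/
noncomputable def dualLog (Q x : ℝ) : ℝ := Real.log (1 + Q * x) - Real.log (1 - x)

/-- The logarithm of the weight enumerator of the `q`-ary parity check of length `n`
(`q = Q + 1`), evaluated at `(1 - x) / (1 + Q x)`. -/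
noncomputable def logWeight (Q : ℝ) (n : ℕ) (x : ℝ) : ℝ :=
  ((n : ℝ) - 1) * Real.log (1 + Q) + Real.log (1 + Q * x ^ n) - n * Real.log (1 + Q * x)

/-- The relative weight for which `x` is the critical point of the parity check of
length `m + 1`. -/
noncomputable def critWeight (Q : ℝ) (m : ℕ) (x : ℝ) : ℝ :=
  Q * (1 - x) * (1 - x ^ m) / ((1 + Q) * (1 + Q * x ^ (m + 1)))

/-- The `(Q + 1)`-ary entropy in nats. -/
noncomputable def natEntropy (Q lam : ℝ) : ℝ :=
  lam * Real.log Q - lam * Real.log lam - (1 - lam) * Real.log (1 - lam)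

section

variable {Q x : ℝ}

theorem dualLog_pos (hQ : 0 < Q) (h0 : 0 < x) (h1 : x < 1) : 0 < dualLog Q x :=
  sub_pos.2 (Real.log_lt_log (by linarith) (by nlinarith))

theorem dualLog_nonneg (hQ : 0 < Q) (h0 : 0 ≤ x) (h1 : x < 1) : 0 ≤ dualLog Q x :=
  sub_nonneg.2 (Real.log_le_log (by linarith) (by nlinarith))

theorem dualLog_le (hQ : 0 < Q) (h0 : 0 ≤ x) (h1 : x < 1) :
    dualLog Q x ≤ (Q + 1) * x / (1 - x) := by
  have hx : 0 < 1 - x := by linarith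
  have hQx : 0 < 1 + Q * x := by positivity
  rw [dualLog, ← Real.log_div hQx.ne' hx.ne']
  refine (Real.log_le_sub_one_of_pos (by positivity)).trans_eq ?_
  field_simp
  ring

theorem hasDerivAt_dualLog (hQ : 0 < Q) (h0 : 0 ≤ x) (h1 : x < 1) :
    HasDerivAt (dualLog Q) ((Q + 1) / ((1 + Q * x) * (1 - x))) x := by
  have hx : 0 < 1 - x := by linarith
  have hQx : 0 < 1 + Q * x := by positivity
  have hA := (((hasDerivAt_id x).const_mul Q).const_add 1).log hQx.ne'
  have hB := ((hasDerivAt_id x).const_sub 1).log hx.ne'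
  refine (hA.sub hB).congr_deriv ?_
  simp only [id]
  field_simp
  ring

theorem dualLog_strictMonoOn (hQ : 0 < Q) : StrictMonoOn (dualLog Q) (Set.Ico 0 1) := by
  refine strictMonoOn_of_deriv_pos (convex_Ico 0 1)
    (fun x hx => (hasDerivAt_dualLog hQ hx.1 hx.2).continuousAt.continuousWithinAt) fun x hx => ?_
  rw [interior_Ico] at hx
  have h0 := hx.1
  have : 0 < 1 - x := by linarith [hx.2]
  rw [(hasDerivAt_dualLog hQ h0.le hx.2).deriv]
  positivity

theorem dualLog_mul_monotoneOn (hQ : 0 < Q) :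
    MonotoneOn (fun x => dualLog Q x * (1 / x + 2 * Q + Q ^ 2 * x)) (Set.Ioo 0 1) := by
  have hder : ∀ x ∈ Set.Ioo (0 : ℝ) 1,
      HasDerivAt (fun x => dualLog Q x * (1 / x + 2 * Q + Q ^ 2 * x))
        ((1 + Q * x) / x ^ 2 * ((Q + 1) * x / (1 - x) - dualLog Q x * (1 - Q * x))) x := by
    intro x hx
    have h0 := hx.1
    have hx1 : 0 < 1 - x := by linarith [hx.2]
    have hQx : 0 < 1 + Q * x := by positivity
    have hA : HasDerivAt (fun x : ℝ => 1 / x + 2 * Q + Q ^ 2 * x) (-(x ^ 2)⁻¹ + Q ^ 2) x := by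
      have := ((hasDerivAt_inv h0.ne').add_const (2 * Q)).add
        ((hasDerivAt_id x).const_mul (Q ^ 2))
      simpa [one_div, Pi.add_def] using this
    refine ((hasDerivAt_dualLog hQ h0.le hx.2).mul hA).congr_deriv ?_
    field_simp
    ring
  refine monotoneOn_of_deriv_nonneg (convex_Ioo 0 1)
    (fun x hx => (hder x hx).continuousAt.continuousWithinAt)
    (fun x hx => (hder x (interior_subset hx)).differentiableAt.differentiableWithinAt)
    fun x hx => ?_
  replace hx := interior_subset hx
  have h0 := hx.1
  rw [(hder x hx).deriv]
  refine mul_nonneg (by positivity) ?_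
  have h1 := dualLog_le hQ h0.le hx.2
  have h2 := dualLog_nonneg hQ h0.le hx.2
  have h3 : 0 ≤ dualLog Q x * (Q * x) := by positivity
  linarith

theorem mul_log_one_add_le {r u v : ℝ} (hr : 0 ≤ r) (hr1 : r ≤ 1) (hu : 0 ≤ u)
    (h : r * u ≤ v) : r * Real.log (1 + u) ≤ Real.log (1 + v) := by
  have hu' : 0 < 1 + u := by linarith
  rw [← Real.log_rpow hu']
  refine Real.log_le_log (by positivity) ?_
  have := rpow_one_add_le_one_add_mul_self (s := u) (by linarith) hr hr1
  linarith

/-- With `X Y = x y` and `y ≤ Y ≤ X ≤ x`, the comparison of `z ↦ z / (1 + Q z)²` at `(X, Y)`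
follows from the one at `(x, y)`. -/
theorem reflect_weight_le {r y X Y : ℝ} (hQ : 0 < Q) (hr1 : r ≤ 1)
    (hy : 0 < y) (hyY : y ≤ Y) (hYX : Y ≤ X) (hXx : X ≤ x) (hprod : X * Y = x * y)
    (h : r * (1 / y + 2 * Q + Q ^ 2 * y) ≤ 1 / x + 2 * Q + Q ^ 2 * x) :
    r * (X / (1 + Q * X) ^ 2) ≤ Y / (1 + Q * Y) ^ 2 := by
  have hY : 0 < Y := by linarith
  have hX : 0 < X := by linarith
  have hx : 0 < x := by linarith
  obtain ⟨p, hp⟩ : ∃ p, p = x * y := ⟨_, rfl⟩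
  have hp0 : 0 < p := by rw [hp]; positivity
  have inv_eq : ∀ {a b : ℝ}, 0 < a → 0 < b → a * b = p → 1 / a = b * p⁻¹ := by
    intro a b ha hb hab
    rw [← hab]
    field_simp
  have hp0' : 0 < p⁻¹ := by positivity
  rw [inv_eq hx hy hp.symm, inv_eq hy hx (by rw [hp]; ring)] at h
  have goal : r * (X * p⁻¹ + 2 * Q + Q ^ 2 * Y) ≤ Y * p⁻¹ + 2 * Q + Q ^ 2 * X := by
    generalize p⁻¹ = w at *
    have h2Q : 0 ≤ 2 * Q * (1 - r) := mul_nonneg (by linarith) (by linarith)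
    have hQ2 : 0 < Q ^ 2 := by positivity
    rcases le_total w (Q ^ 2) with hw | hw
    · have h1 : 0 ≤ (X - Y) * (Q ^ 2 - w) := mul_nonneg (by linarith) (by linarith)
      have h2 : 0 ≤ (1 - r) * (X * w + 2 * Q + Q ^ 2 * Y) :=
        mul_nonneg (by linarith) (by positivity)
      nlinarith
    · have hc : 0 ≤ w - r * Q ^ 2 := by nlinarith
      rcases le_total (r * w) (Q ^ 2) with hd | hd
      · have h1 : 0 ≤ X * (Q ^ 2 - r * w) := mul_nonneg hX.le (by linarith)
        have h2 : 0 ≤ Y * (w - r * Q ^ 2) := mul_nonneg hY.le hc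
        nlinarith
      · have h1 : 0 ≤ (x - X) * (r * w - Q ^ 2) := mul_nonneg (by linarith) (by linarith)
        have h2 : 0 ≤ (Y - y) * (w - r * Q ^ 2) := mul_nonneg (by linarith) hc
        nlinarith
  have hXY : X * Y = p := hprod.trans hp.symm
  rw [← inv_eq hX hY hXY, ← inv_eq hY hX (by rw [← hXY]; ring)] at goal
  have e : ∀ {z : ℝ}, 0 < z → z / (1 + Q * z) ^ 2 = (1 / z + 2 * Q + Q ^ 2 * z)⁻¹ := by
    intro z hz
    have : 1 / z + 2 * Q + Q ^ 2 * z = (1 + Q * z) ^ 2 / z := by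
      field_simp
      ring
    rw [this, inv_div]
  rw [e hX, e hY, ← div_eq_mul_inv, ← one_div, div_le_div_iff₀ (by positivity) (by positivity)]
  linarith

theorem logWeight_secondDiff (hQ : 0 < Q) (h0 : 0 < x) (i : ℕ) :
    logWeight Q (i + 2) x - 2 * logWeight Q (i + 1) x + logWeight Q i x =
      Real.log (1 + Q * (1 - x) ^ 2 / x * (x ^ (i + 1) / (1 + Q * x ^ (i + 1)) ^ 2)) := by
  have hA : 0 < 1 + Q * x ^ (i + 2) := by positivity
  have hB : 0 < 1 + Q * x ^ (i + 1) := by positivity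
  have hC : 0 < 1 + Q * x ^ i := by positivity
  have : 1 + Q * (1 - x) ^ 2 / x * (x ^ (i + 1) / (1 + Q * x ^ (i + 1)) ^ 2) =
      (1 + Q * x ^ (i + 2)) * (1 + Q * x ^ i) / (1 + Q * x ^ (i + 1)) ^ 2 := by
    field_simp
    ring
  rw [this, Real.log_div (by positivity) (by positivity), Real.log_mul hA.ne' hC.ne',
    Real.log_pow]
  simp only [logWeight]
  push_cast
  ring

theorem logWeight_zero : logWeight Q 0 x = 0 := by simp [logWeight]

theorem logWeight_one : logWeight Q 1 x = 0 := by simp [logWeight]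

/-- The inequality that governs the sign of the derivative of the ratio. -/
theorem dualLog_mul_logWeight_lt (hQ : 0 < Q) (h0 : 0 < x) (h1 : x < 1) {m : ℕ} (hm : 2 ≤ m) :
    (dualLog Q x + dualLog Q (x ^ m)) * logWeight Q (m + 1) x <
      (m + 1) * dualLog Q x * (logWeight Q (m + 1) x - logWeight Q m x) := by
  have hy0 : 0 < x ^ m := by positivity
  have hyx : x ^ m < x := pow_lt_self_of_lt_one₀ h0 h1 (by omega)
  have hν := dualLog_pos hQ h0 h1
  have hνy := dualLog_pos hQ hy0 (hyx.trans h1)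
  have hνlt := dualLog_strictMonoOn hQ ⟨hy0.le, hyx.trans h1⟩ ⟨h0.le, h1⟩ hyx
  obtain ⟨r, hr⟩ : ∃ r, r = dualLog Q (x ^ m) / dualLog Q x := ⟨_, rfl⟩
  have hr0 : 0 ≤ r := by rw [hr]; positivity
  have hr1 : r < 1 := by rw [hr, div_lt_one hν]; exact hνlt
  have hνr : dualLog Q (x ^ m) = r * dualLog Q x := by rw [hr]; field_simp
  have hmono := dualLog_mul_monotoneOn hQ ⟨hy0, hyx.trans h1⟩ ⟨h0, h1⟩ hyx.le
  simp only [hνr] at hmono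
  have hend : r * (1 / x ^ m + 2 * Q + Q ^ 2 * x ^ m) ≤ 1 / x + 2 * Q + Q ^ 2 * x :=
    le_of_mul_le_mul_left (by linarith) hν
  have hθ : 0 < Q * (1 - x) ^ 2 / x := by
    have : 0 < 1 - x := by linarith
    positivity
  have main := mul_lt_of_secondDiff_reflect (fun n => logWeight Q n x) logWeight_zero
    logWeight_one (show 0 < m by omega) hr0 hr1
    (fun i => by
      rw [logWeight_secondDiff hQ h0]
      refine Real.log_pos ?_
      have : 0 < Q * (1 - x) ^ 2 / x * (x ^ (i + 1) / (1 + Q * x ^ (i + 1)) ^ 2) := by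
        positivity
      linarith)
    (fun i j hij hijm => by
      rw [logWeight_secondDiff hQ h0, logWeight_secondDiff hQ h0]
      refine mul_log_one_add_le hr0 hr1.le (by positivity) ?_
      have := reflect_weight_le (X := x ^ (i + 1)) (Y := x ^ (j + 1)) hQ hr1.le hy0
        (pow_le_pow_of_le_one h0.le h1.le (by omega))
        (pow_le_pow_of_le_one h0.le h1.le (by omega))
        (pow_le_of_le_one h0.le h1.le (by omega))
        (by rw [← pow_add, ← pow_succ']; congr 1; omega) hend
      nlinarith [mul_le_mul_of_nonneg_left this hθ.le])
  rw [hνr]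
  nlinarith [mul_lt_mul_of_pos_left main hν]

theorem critWeight_pos (hQ : 0 < Q) (h0 : 0 ≤ x) (h1 : x < 1) {m : ℕ} (hm : m ≠ 0) :
    0 < critWeight Q m x := by
  have hx : 0 < 1 - x := by linarith
  have hxm : 0 < 1 - x ^ m := by linarith [pow_lt_one₀ h0 h1 hm]
  unfold critWeight
  positivity

theorem one_sub_critWeight (hQ : 0 < Q) (h0 : 0 ≤ x) (m : ℕ) :
    1 - critWeight Q m x =
      (1 + Q * x) * (1 + Q * x ^ m) / ((1 + Q) * (1 + Q * x ^ (m + 1))) := by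
  have : 0 < 1 + Q * x ^ (m + 1) := by positivity
  unfold critWeight
  field_simp
  ring

theorem log_critWeight (hQ : 0 < Q) (h0 : 0 ≤ x) (h1 : x < 1) {m : ℕ} (hm : m ≠ 0) :
    Real.log (critWeight Q m x) = Real.log Q + Real.log (1 - x) + Real.log (1 - x ^ m) -
      Real.log (1 + Q) - Real.log (1 + Q * x ^ (m + 1)) := by
  have hx : 0 < 1 - x := by linarith
  have hxm : 0 < 1 - x ^ m := by linarith [pow_lt_one₀ h0 h1 hm]
  have : 0 < 1 + Q * x ^ (m + 1) := by positivity
  unfold critWeight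
  rw [Real.log_div (by positivity) (by positivity), Real.log_mul (by positivity) hxm.ne',
    Real.log_mul hQ.ne' hx.ne', Real.log_mul (by positivity) this.ne']
  ring

theorem log_one_sub_critWeight (hQ : 0 < Q) (h0 : 0 ≤ x) (m : ℕ) :
    Real.log (1 - critWeight Q m x) = logWeight Q m x - logWeight Q (m + 1) x := by
  have hA : 0 < 1 + Q * x ^ (m + 1) := by positivity
  have hB : 0 < 1 + Q * x ^ m := by positivity
  have hC : 0 < 1 + Q * x := by positivity
  rw [one_sub_critWeight hQ h0, Real.log_div (by positivity) (by positivity),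
    Real.log_mul hC.ne' hB.ne', Real.log_mul (by positivity) hA.ne']
  simp only [logWeight]
  push_cast
  ring

theorem entropy_slope_critWeight (hQ : 0 < Q) (h0 : 0 ≤ x) (h1 : x < 1) {m : ℕ} (hm : m ≠ 0) :
    Real.log Q - Real.log (critWeight Q m x) + Real.log (1 - critWeight Q m x) =
      dualLog Q x + dualLog Q (x ^ m) := by
  rw [log_critWeight hQ h0 h1 hm, log_one_sub_critWeight hQ h0]
  simp only [logWeight, dualLog]
  push_cast
  ring

theorem natEntropy_critWeight (hQ : 0 < Q) (h0 : 0 ≤ x) (h1 : x < 1) {m : ℕ} (hm : m ≠ 0) :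
    natEntropy Q (critWeight Q m x) = (logWeight Q (m + 1) x - logWeight Q m x) +
      critWeight Q m x * (dualLog Q x + dualLog Q (x ^ m)) := by
  rw [← entropy_slope_critWeight hQ h0 h1 hm]
  have := log_one_sub_critWeight hQ h0 m
  unfold natEntropy
  linear_combination (-1 : ℝ) * this

theorem one_sub_critWeight_pos (hQ : 0 < Q) (h0 : 0 ≤ x) (m : ℕ) : 0 < 1 - critWeight Q m x := by
  rw [one_sub_critWeight hQ h0]
  positivity

theorem natEntropy_critWeight_pos (hQ : 0 < Q) (h0 : 0 ≤ x) (h1 : x < 1) {m : ℕ} (hm : m ≠ 0) :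
    0 < natEntropy Q (critWeight Q m x) := by
  rw [natEntropy_critWeight hQ h0 h1 hm]
  have hpos := critWeight_pos hQ h0 h1 hm
  have hlog := Real.log_neg (one_sub_critWeight_pos hQ h0 m) (by linarith)
  rw [log_one_sub_critWeight hQ h0] at hlog
  have hA := dualLog_nonneg hQ h0 h1
  have hB := dualLog_nonneg hQ (pow_nonneg h0 m) (pow_lt_one₀ h0 h1 hm)
  have : 0 ≤ critWeight Q m x * (dualLog Q x + dualLog Q (x ^ m)) := by positivity
  linarith

theorem hasDerivAt_logWeight (hQ : 0 < Q) (h0 : 0 ≤ x) (h1 : x < 1) (m : ℕ) :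
    HasDerivAt (logWeight Q (m + 1))
      (-((m + 1) * critWeight Q m x * ((Q + 1) / ((1 + Q * x) * (1 - x))))) x := by
  have hA : 0 < 1 + Q * x ^ (m + 1) := by positivity
  have hC : 0 < 1 + Q * x := by positivity
  have hx : 0 < 1 - x := by linarith
  have h2 := (((hasDerivAt_pow (m + 1) x).const_mul Q).const_add 1).log hA.ne'
  have h3 := ((((hasDerivAt_id x).const_mul Q).const_add 1).log hC.ne').const_mul
    (((m + 1 : ℕ) : ℝ))
  refine ((h2.const_add ((((m + 1 : ℕ) : ℝ) - 1) * Real.log (1 + Q))).sub h3).congr_deriv ?_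
  simp only [id, critWeight, Nat.add_sub_cancel]
  push_cast
  field_simp
  ring

theorem exists_hasDerivAt_critWeight (hQ : 0 < Q) (h0 : 0 ≤ x) (h1 : x < 1) {m : ℕ}
    (hm : m ≠ 0) : ∃ c < 0, HasDerivAt (critWeight Q m) c x := by
  have hA : 0 < 1 + Q * x ^ (m + 1) := by positivity
  have hx : 0 < 1 - x := by linarith
  have hxm : 0 < 1 - x ^ m := by linarith [pow_lt_one₀ h0 h1 hm]
  have hnum := (((hasDerivAt_id x).const_sub 1).const_mul Q).mul ((hasDerivAt_pow m x).const_sub 1)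
  have hden := (((hasDerivAt_pow (m + 1) x).const_mul Q).const_add 1).const_mul (1 + Q)
  refine ⟨_, ?_, hnum.div hden (by positivity)⟩
  refine div_neg_of_neg_of_pos ?_ (by positivity)
  simp only [id, Pi.mul_apply]
  have e1 : 0 < Q * (1 - x ^ m) * ((1 + Q) * (1 + Q * x ^ (m + 1))) := by positivity
  have e2 : 0 ≤ Q * (1 - x) * (m * x ^ (m - 1)) * ((1 + Q) * (1 + Q * x ^ (m + 1))) := by
    positivity
  have e3 : 0 ≤ Q * (1 - x) * (1 - x ^ m) *
      ((1 + Q) * (Q * (((m + 1 : ℕ) : ℝ) * x ^ (m + 1 - 1)))) := by positivity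
  nlinarith

theorem critWeight_strictAntiOn (hQ : 0 < Q) {m : ℕ} (hm : m ≠ 0) :
    StrictAntiOn (critWeight Q m) (Set.Ico 0 1) := by
  refine strictAntiOn_of_deriv_neg (convex_Ico 0 1) (fun x hx => ?_) fun x hx => ?_
  · obtain ⟨c, -, h⟩ := exists_hasDerivAt_critWeight hQ hx.1 hx.2 hm
    exact h.continuousAt.continuousWithinAt
  · replace hx := interior_subset hx
    obtain ⟨c, hc, h⟩ := exists_hasDerivAt_critWeight hQ hx.1 hx.2 hm
    rwa [h.deriv]

theorem exists_critWeight_eq (hQ : 0 < Q) {m : ℕ} (hm : m ≠ 0) {lam : ℝ} (hlam : 0 < lam)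
    (hlam' : lam ≤ Q / (1 + Q)) : ∃ x ∈ Set.Ico (0 : ℝ) 1, critWeight Q m x = lam := by
  have hcont : ContinuousOn (critWeight Q m) (Set.Icc 0 1) := by
    unfold critWeight
    refine ContinuousOn.div (by fun_prop) (by fun_prop) fun x hx => ?_
    have := hx.1
    positivity
  have hsub := intermediate_value_Icc' zero_le_one hcont
  have hz : critWeight Q m 0 = Q / (1 + Q) := by simp [critWeight, hm]
  have ho : critWeight Q m 1 = 0 := by simp [critWeight]
  obtain ⟨x, hx, rfl⟩ := hsub (show lam ∈ _ by rw [hz, ho]; exact ⟨hlam.le, hlam'⟩)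
  refine ⟨x, ⟨hx.1, lt_of_le_of_ne hx.2 ?_⟩, rfl⟩
  rintro rfl
  exact hlam.ne' ho

/-- `x` minimizes the dual objective for the relative weight `critWeight Q m x`. -/
theorem logWeight_add_le (hQ : 0 < Q) {m : ℕ} (hm : m ≠ 0) {z : ℝ}
    (hx : x ∈ Set.Ico (0 : ℝ) 1) (hz : z ∈ Set.Ico (0 : ℝ) 1) :
    logWeight Q (m + 1) x + (m + 1) * critWeight Q m x * dualLog Q x ≤
      logWeight Q (m + 1) z + (m + 1) * critWeight Q m x * dualLog Q z := by
  have hder : ∀ w ∈ Set.Ico (0 : ℝ) 1, HasDerivAt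
      (fun w => logWeight Q (m + 1) w + (m + 1) * critWeight Q m x * dualLog Q w)
      ((m + 1) * ((Q + 1) / ((1 + Q * w) * (1 - w))) * (critWeight Q m x - critWeight Q m w))
      w := by
    intro w hw
    refine ((hasDerivAt_logWeight hQ hw.1 hw.2 m).add
      ((hasDerivAt_dualLog hQ hw.1 hw.2).const_mul _)).congr_deriv ?_
    ring
  have hanti := (critWeight_strictAntiOn hQ hm).antitoneOn
  have hfac : ∀ w ∈ Set.Ico (0 : ℝ) 1,
      0 ≤ ((m : ℝ) + 1) * ((Q + 1) / ((1 + Q * w) * (1 - w))) := by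
    intro w hw
    have h0 := hw.1
    have : 0 < 1 - w := by linarith [hw.2]
    positivity
  rcases le_total z x with hzx | hxz
  · have hs : Set.Icc z x ⊆ Set.Ico (0 : ℝ) 1 := fun w hw =>
      ⟨hz.1.trans hw.1, hw.2.trans_lt hx.2⟩
    refine antitoneOn_of_deriv_nonpos (convex_Icc z x)
      (fun w hw => (hder w (hs hw)).continuousAt.continuousWithinAt)
      (fun w hw => (hder w (hs (interior_subset hw))).differentiableAt.differentiableWithinAt)
      (fun w hw => ?_) ⟨le_rfl, hzx⟩ ⟨hzx, le_rfl⟩ hzx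
    replace hw := interior_subset hw
    rw [(hder w (hs hw)).deriv]
    exact mul_nonpos_of_nonneg_of_nonpos (hfac w (hs hw))
      (sub_nonpos.2 (hanti (hs hw) hx hw.2))
  · have hs : Set.Icc x z ⊆ Set.Ico (0 : ℝ) 1 := fun w hw =>
      ⟨hx.1.trans hw.1, hw.2.trans_lt hz.2⟩
    refine monotoneOn_of_deriv_nonneg (convex_Icc x z)
      (fun w hw => (hder w (hs hw)).continuousAt.continuousWithinAt)
      (fun w hw => (hder w (hs (interior_subset hw))).differentiableAt.differentiableWithinAt)
      (fun w hw => ?_) ⟨le_rfl, hxz⟩ ⟨hxz, le_rfl⟩ hxz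
    replace hw := interior_subset hw
    rw [(hder w (hs hw)).deriv]
    exact mul_nonneg (hfac w (hs hw)) (sub_nonneg.2 (hanti hx (hs hw) hw.1))

theorem hasDerivAt_natEntropy {lam : ℝ} (h0 : 0 < lam) (h1 : 0 < 1 - lam) :
    HasDerivAt (natEntropy Q) (Real.log Q - Real.log lam + Real.log (1 - lam)) lam := by
  have hA := (hasDerivAt_id lam).mul_const (Real.log Q)
  have hB := (hasDerivAt_id lam).mul ((hasDerivAt_id lam).log h0.ne')
  have hC := ((hasDerivAt_id lam).const_sub 1).mul (((hasDerivAt_id lam).const_sub 1).log h1.ne')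
  refine ((hA.sub hB).sub hC).congr_deriv ?_
  simp only [id]
  field_simp
  ring

theorem dualValue_div_natEntropy_strictAntiOn (hQ : 0 < Q) {m : ℕ} (hm : 2 ≤ m) :
    StrictAntiOn (fun x => (logWeight Q (m + 1) x + (m + 1) * critWeight Q m x * dualLog Q x) /
      natEntropy Q (critWeight Q m x)) (Set.Ico 0 1) := by
  have hm0 : m ≠ 0 := by omega
  have hder : ∀ x ∈ Set.Ico (0 : ℝ) 1, ∃ c < 0, HasDerivAt
      (fun x => (logWeight Q (m + 1) x + (m + 1) * critWeight Q m x * dualLog Q x) /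
        natEntropy Q (critWeight Q m x))
      (c * ((m + 1) * dualLog Q x * (logWeight Q (m + 1) x - logWeight Q m x) -
        (dualLog Q x + dualLog Q (x ^ m)) * logWeight Q (m + 1) x) /
          natEntropy Q (critWeight Q m x) ^ 2) x := by
    intro x hx
    obtain ⟨c, hc, hcw⟩ := exists_hasDerivAt_critWeight hQ hx.1 hx.2 hm0
    have hent := (hasDerivAt_natEntropy (Q := Q) (critWeight_pos hQ hx.1 hx.2 hm0)
      (one_sub_critWeight_pos hQ hx.1 m)).comp x hcw
    rw [entropy_slope_critWeight hQ hx.1 hx.2 hm0] at hent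
    have hnum := (hasDerivAt_logWeight hQ hx.1 hx.2 m).add
      ((hcw.const_mul ((m : ℝ) + 1)).mul (hasDerivAt_dualLog hQ hx.1 hx.2))
    refine ⟨c, hc, (hnum.div hent
      (natEntropy_critWeight_pos hQ hx.1 hx.2 hm0).ne').congr_deriv ?_⟩
    simp only [Function.comp_apply, Pi.add_apply, Pi.mul_apply]
    congr 1
    rw [natEntropy_critWeight hQ hx.1 hx.2 hm0]
    ring
  refine strictAntiOn_of_deriv_neg (convex_Ico 0 1) (fun x hx => ?_) fun x hx => ?_
  · obtain ⟨c, -, h⟩ := hder x hx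
    exact h.continuousAt.continuousWithinAt
  · obtain ⟨c, hc, h⟩ := hder x (interior_subset hx)
    rw [interior_Ico] at hx
    have hpos := natEntropy_critWeight_pos hQ hx.1.le hx.2 hm0
    rw [h.deriv]
    exact div_neg_of_neg_of_pos (mul_neg_of_neg_of_pos hc
      (sub_pos.2 (dualLog_mul_logWeight_lt hQ hx.1 hx.2 hm))) (by positivity)

end

theorem qEntropy_eq_natEntropy_div (q : ℕ) (lam : ℝ) :
    qEntropy q lam = natEntropy ((q : ℝ) - 1) lam / Real.log q := by
  simp only [qEntropy, natEntropy, Real.logb]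
  ring

theorem psiFun_eq {q : ℕ} (hq : 1 < q) (m : ℕ) {lam z : ℝ} (h0 : 0 < lam) (h1 : 0 < 1 - lam)
    (hz : z ∈ Set.Ico (0 : ℝ) 1) :
    psiFun q (m + 1) lam (((q : ℝ) - 1) * (1 - z) / q) =
      (logWeight ((q : ℝ) - 1) (m + 1) z + (m + 1) * lam * dualLog ((q : ℝ) - 1) z -
        (m + 1) * natEntropy ((q : ℝ) - 1) lam) / Real.log q := by
  obtain ⟨Q, hQ⟩ : ∃ Q : ℝ, Q = (q : ℝ) - 1 := ⟨_, rfl⟩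
  have hq' : (q : ℝ) = 1 + Q := by rw [hQ]; ring
  have hQ0 : 0 < Q := by
    have : (1 : ℝ) < q := by exact_mod_cast hq
    linarith
  have hz0 := hz.1
  have hz1 : 0 < 1 - z := by linarith [hz.2]
  have hA : 0 < 1 + Q * z := by positivity
  have hB : 0 < 1 + Q * z ^ (m + 1) := by positivity
  simp only [psiFun, klDiv, Zfun, Real.logb, logWeight, dualLog, natEntropy, ← hQ]
  rw [hq']
  have e1 : 1 - Q * (1 - z) / (1 + Q) = (1 + Q * z) / (1 + Q) := by
    field_simp
    ring
  have e2 : 1 - (1 + Q) * (Q * (1 - z) / (1 + Q)) / Q = z := by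
    field_simp
    ring
  rw [e1, e2, Real.log_div h0.ne' (by positivity), Real.log_div h1.ne' (by positivity),
    Real.log_div (by positivity) (by positivity), Real.log_div (by positivity) (by positivity),
    Real.log_div (by positivity) (by positivity), Real.log_mul hQ0.ne' hz1.ne']
  push_cast
  ring

theorem phiFun_critWeight {q : ℕ} (hq : 1 < q) {m : ℕ} (hm : m ≠ 0) {x : ℝ}
    (hx : x ∈ Set.Ico (0 : ℝ) 1) :
    phiFun q (m + 1) (critWeight ((q : ℝ) - 1) m x) =
      (logWeight ((q : ℝ) - 1) (m + 1) x +
        (m + 1) * critWeight ((q : ℝ) - 1) m x * dualLog ((q : ℝ) - 1) x -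
        (m + 1) * natEntropy ((q : ℝ) - 1) (critWeight ((q : ℝ) - 1) m x)) / Real.log q := by
  have hq' : (1 : ℝ) < q := by exact_mod_cast hq
  have hQ : 0 < (q : ℝ) - 1 := by linarith
  have hlam := critWeight_pos hQ hx.1 hx.2 hm
  have hlam' := one_sub_critWeight_pos hQ hx.1 m
  rw [← psiFun_eq hq m hlam hlam' hx, phiFun]
  refine IsLeast.csInf_eq ⟨⟨_, ⟨?_, ?_⟩, rfl⟩, ?_⟩
  · have : 0 < 1 - x := by linarith [hx.2]
    positivity
  · gcongr
    nlinarith [hx.1]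
  · rintro _ ⟨β, hβ, rfl⟩
    obtain ⟨z, hz⟩ : ∃ z, z = 1 - (q : ℝ) * β / ((q : ℝ) - 1) := ⟨_, rfl⟩
    have hβz : β = ((q : ℝ) - 1) * (1 - z) / q := by
      rw [hz]
      field_simp
      ring
    have hzmem : z ∈ Set.Ico (0 : ℝ) 1 := by
      have h1 := hβ.1
      have h2 := hβ.2
      rw [le_div_iff₀ (by linarith)] at h2
      rw [hz]
      constructor
      · rw [sub_nonneg, div_le_one hQ]
        linarith
      · have : 0 < (q : ℝ) * β / ((q : ℝ) - 1) := by positivity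
        linarith
    rw [hβz, psiFun_eq hq m hlam hlam' hx, psiFun_eq hq m hlam hlam' hzmem]
    have := logWeight_add_le hQ hm hx hzmem
    have hlog := Real.log_pos hq'
    gcongr

/-- **Lemma 5.1, item 3.** The function `λ ↦ φ(λ)/h_q(λ)` is strictly
increasing on `(0, (q−1)/q]`. -/
theorem phi_div_entropy_strictMonoOn
    (q : ℕ) (F : Type) [Field F] [Fintype F] [DecidableEq F]
    (hcard : Fintype.card F = q) (s : ℕ) (hs : 3 ≤ s) :
    StrictMonoOn (fun lam => phiFun q s lam / qEntropy q lam)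
      (Set.Ioc (0 : ℝ) (((q : ℝ) - 1) / q)) := by
  have hq : 1 < q := hcard ▸ Fintype.one_lt_card
  have hq' : (1 : ℝ) < q := by exact_mod_cast hq
  have hQ : 0 < (q : ℝ) - 1 := by linarith
  obtain ⟨m, rfl⟩ : ∃ m, s = m + 1 := ⟨s - 1, by omega⟩
  have hm : 2 ≤ m := by omega
  have hm0 : m ≠ 0 := by omega
  have hratio : ∀ x ∈ Set.Ico (0 : ℝ) 1,
      phiFun q (m + 1) (critWeight ((q : ℝ) - 1) m x) /
        qEntropy q (critWeight ((q : ℝ) - 1) m x) =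
      (logWeight ((q : ℝ) - 1) (m + 1) x +
        (m + 1) * critWeight ((q : ℝ) - 1) m x * dualLog ((q : ℝ) - 1) x) /
        natEntropy ((q : ℝ) - 1) (critWeight ((q : ℝ) - 1) m x) - (m + 1) := by
    intro x hx
    have hpos := natEntropy_critWeight_pos hQ hx.1 hx.2 hm0
    rw [phiFun_critWeight hq hm0 hx, qEntropy_eq_natEntropy_div,
      div_div_div_cancel_right₀ (Real.log_pos hq').ne', sub_div, mul_div_assoc,
      div_self hpos.ne', mul_one]
  have hq1 : (1 : ℝ) + ((q : ℝ) - 1) = q := by ring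
  intro a ha b hb hab
  obtain ⟨x, hx, rfl⟩ := exists_critWeight_eq hQ hm0 ha.1 (by rw [hq1]; exact ha.2)
  obtain ⟨y, hy, rfl⟩ := exists_critWeight_eq hQ hm0 hb.1 (by rw [hq1]; exact hb.2)
  have hyx : y < x := ((critWeight_strictAntiOn hQ hm0).lt_iff_gt hx hy).1 hab
  have := dualValue_div_natEntropy_strictAntiOn hQ hm hy hx hyx
  simp only [hratio x hx, hratio y hy]
  linarith
end

section
/- Fix a prime power q and an integer s ≥ 2, and let λ ∈ (0, (q−1)/q]. Then the function β ↦ ψ(λ,β) attains its minimum over β ∈ (0, (q−1)/q] at a unique point, and this minimizer is the unique β ∈ (0, (q−1)/q] satisfying E_{w∼μ_q(β)^s}[wt(w) | w_1 + ⋯ + w_s = 0] = λ. -/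
open Finset

/-- The distribution `μ_q(β)` on a finite field `F` of size `q`: probability `1-β` on `0`
and `β/(q-1)` on each nonzero element. -/
noncomputable def muDist {F : Type} [DecidableEq F] [Zero F] (q : ℕ) (β : ℝ) (a : F) : ℝ :=
  if a = 0 then 1 - β else β / (q - 1)

/-- `E_{w∼μ_q(β)^s}[wt(w) | w_1 + ⋯ + w_s = 0]`: the conditional expectation of the
relative Hamming weight of `s` i.i.d. samples from `μ_q(β)` given that they sum to zero. -/
noncomputable def condWt (F : Type) [Field F] [Fintype F] [DecidableEq F]
    (q s : ℕ) (β : ℝ) : ℝ :=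
  (∑ w ∈ Finset.univ.filter (fun w : Fin s → F => ∑ i, w i = 0),
      (∏ i, muDist q β (w i)) *
        (((Finset.univ.filter fun i : Fin s => w i ≠ 0).card : ℝ) / s)) /
  ∑ w ∈ Finset.univ.filter (fun w : Fin s → F => ∑ i, w i = 0), ∏ i, muDist q β (w i)

/-- The words of length `s` over `F` whose coordinates sum to `c`. -/
abbrev sumWords (F : Type) [Field F] [Fintype F] [DecidableEq F] (s : ℕ) (c : F) :
    Finset (Fin s → F) :=
  Finset.univ.filter fun w => ∑ i, w i = c

/-- The Hamming weight of a word. -/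
abbrev wordWt {F : Type} [Field F] [DecidableEq F] {s : ℕ} (w : Fin s → F) : ℕ :=
  (Finset.univ.filter fun i : Fin s => w i ≠ 0).card

theorem prod_ite_zero_eq_pow_wordWt {F : Type} [Field F] [DecidableEq F] {s : ℕ}
    (w : Fin s → F) (x : ℝ) : ∏ i, (if w i = 0 then 1 else x) = x ^ wordWt w := by
  rw [Finset.prod_ite, Finset.prod_const_one, Finset.prod_const, one_mul]

theorem sum_pow_wordWt {F : Type} [Field F] [Fintype F] [DecidableEq F] (s : ℕ) (c : F) (x : ℝ) :
    ∑ w ∈ sumWords F s c, x ^ wordWt w =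
      ((1 + (Fintype.card F - 1) * x) ^ s +
        ((if c = 0 then (Fintype.card F : ℝ) else 0) - 1) * (1 - x) ^ s) / Fintype.card F := by
  have hq : (Fintype.card F : ℝ) ≠ 0 := by exact_mod_cast Fintype.card_ne_zero
  simp_rw [sumWords, ← prod_ite_zero_eq_pow_wordWt, Finset.sum_filter]
  induction s generalizing c with
  | zero => by_cases hc : c = 0 <;> simp [hc, hq, eq_comm]
  | succ n ih =>
    rw [← (Fin.consEquiv fun _ => F).sum_comp, Fintype.sum_prod_type]
    have hstep (a : F) :
        ∑ w : Fin n → F, (if ∑ i, (Fin.consEquiv fun _ => F) (a, w) i = c then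
            ∏ i, (if (Fin.consEquiv fun _ => F) (a, w) i = 0 then 1 else x) else 0) =
          (x + if a = 0 then 1 - x else 0) *
            ∑ w : Fin n → F, (if ∑ i, w i = c - a then
              ∏ i, (if w i = 0 then 1 else x) else 0) := by
      rw [Finset.mul_sum]
      refine Finset.sum_congr rfl fun w _ => ?_
      simp only [Fin.consEquiv_apply, Fin.sum_univ_succ, Fin.prod_univ_succ, Fin.cons_zero,
        Fin.cons_succ, eq_sub_iff_add_eq', mul_ite, mul_zero]
      congr 2
      split_ifs <;> ring
    simp_rw [hstep, ih, add_mul, ite_mul, zero_mul, Finset.sum_add_distrib]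
    rw [Finset.sum_ite_eq' Finset.univ (0 : F), ← Finset.mul_sum, ← Finset.sum_div,
      Finset.sum_add_distrib, ← Finset.sum_mul, Finset.sum_sub_distrib]
    simp only [sub_eq_zero, Finset.sum_ite_eq', Finset.mem_univ, if_true, Finset.sum_const,
      Finset.card_univ, nsmul_eq_mul, eq_comm (a := c)]
    field_simp
    ring

/-- If `m` is the mean of the exponents `k i` under the weights `x₀ ^ k i`, then
`x ↦ log (∑ x ^ k i) - m * log x` is strictly minimized at `x₀`. -/
theorem log_sum_pow_sub_lt {ι : Type*} (W : Finset ι) (k : ι → ℕ) {m x₀ x : ℝ}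
    (hx₀ : 0 < x₀) (hx : 0 < x) (hne : x ≠ x₀)
    (hm : ∑ i ∈ W, (k i : ℝ) * x₀ ^ k i = m * ∑ i ∈ W, x₀ ^ k i)
    (hW : ∃ i ∈ W, (k i : ℝ) ≠ m) :
    Real.log (∑ i ∈ W, x₀ ^ k i) - m * Real.log x₀ <
      Real.log (∑ i ∈ W, x ^ k i) - m * Real.log x := by
  have hpos : 0 < ∑ i ∈ W, x₀ ^ k i :=
    Finset.sum_pos (fun i _ => pow_pos hx₀ _) (hW.imp fun i hi => hi.1)
  set u := Real.log x - Real.log x₀ with hu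
  have hu0 : u ≠ 0 := fun h => hne (Real.log_injOn_pos hx hx₀ (sub_eq_zero.mp h))
  have hxu : x = x₀ * Real.exp u := by
    rw [hu, Real.exp_sub, Real.exp_log hx, Real.exp_log hx₀]
    field_simp
  have hterm (i : ι) : x ^ k i = Real.exp (m * u) * (x₀ ^ k i * Real.exp ((k i - m) * u)) := by
    rw [hxu, mul_pow, ← Real.exp_nat_mul, mul_left_comm, ← Real.exp_add]
    ring_nf
  have hlt : ∑ i ∈ W, x₀ ^ k i < ∑ i ∈ W, x₀ ^ k i * Real.exp ((k i - m) * u) := by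
    have heq : ∑ i ∈ W, x₀ ^ k i = ∑ i ∈ W, x₀ ^ k i * ((k i - m) * u + 1) := by
      have : ∑ i ∈ W, x₀ ^ k i * ((k i - m) * u + 1) =
          u * (∑ i ∈ W, (k i : ℝ) * x₀ ^ k i - m * ∑ i ∈ W, x₀ ^ k i) + ∑ i ∈ W, x₀ ^ k i := by
        rw [Finset.mul_sum W, ← Finset.sum_sub_distrib, Finset.mul_sum, ← Finset.sum_add_distrib]
        exact Finset.sum_congr rfl fun i _ => by ring
      rw [this, hm, sub_self, mul_zero, zero_add]
    rw [heq]
    obtain ⟨j, hj, hjm⟩ := hW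
    refine Finset.sum_lt_sum
      (fun i _ => mul_le_mul_of_nonneg_left (Real.add_one_le_exp _) (pow_pos hx₀ _).le) ⟨j, hj, ?_⟩
    exact mul_lt_mul_of_pos_left
      (Real.add_one_lt_exp (mul_ne_zero (sub_ne_zero.mpr hjm) hu0)) (pow_pos hx₀ _)
  have hlog := Real.log_lt_log hpos hlt
  simp_rw [hterm]
  rw [← Finset.mul_sum, Real.log_mul (Real.exp_pos _).ne' (hpos.trans hlt).ne', Real.log_exp]
  linarith [mul_sub m (Real.log x) (Real.log x₀)]

/-- The likelihood ratio `x = μ_q(β)(a) / μ_q(β)(0)` of a nonzero `a`. -/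
noncomputable def muRatio (q : ℕ) (β : ℝ) : ℝ := β / ((q - 1) * (1 - β))

theorem lt_one_of_mem_Ioc {q : ℕ} (hq : 2 ≤ q) {β : ℝ}
    (hβ : β ∈ Set.Ioc (0 : ℝ) (((q : ℝ) - 1) / q)) : β < 1 := by
  have hq' : (2 : ℝ) ≤ q := by exact_mod_cast hq
  exact hβ.2.trans_lt ((div_lt_one (by linarith)).mpr (by linarith))

theorem muRatio_pos {q : ℕ} (hq : 2 ≤ q) {β : ℝ}
    (hβ : β ∈ Set.Ioc (0 : ℝ) (((q : ℝ) - 1) / q)) : 0 < muRatio q β := by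
  have hq' : (2 : ℝ) ≤ q := by exact_mod_cast hq
  have hβ1 := lt_one_of_mem_Ioc hq hβ
  exact div_pos hβ.1 (mul_pos (by linarith) (by linarith))

theorem one_sub_mul_muRatio {q : ℕ} (hq : 2 ≤ q) {β : ℝ} (hβ : β < 1) :
    (1 - β) * muRatio q β = β / (q - 1) := by
  have hq' : (2 : ℝ) ≤ q := by exact_mod_cast hq
  have h1 : (q : ℝ) - 1 ≠ 0 := by linarith
  have h2 : 1 - β ≠ 0 := by linarith
  rw [muRatio]
  field_simp

theorem muRatio_injOn {q : ℕ} (hq : 2 ≤ q) :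
    Set.InjOn (muRatio q) (Set.Ioc (0 : ℝ) (((q : ℝ) - 1) / q)) := by
  intro β hβ γ hγ h
  have hq' : (2 : ℝ) ≤ q := by exact_mod_cast hq
  have h1 : (q : ℝ) - 1 ≠ 0 := by linarith
  have h2 : 1 - β ≠ 0 := by linarith [lt_one_of_mem_Ioc hq hβ]
  have h3 : 1 - γ ≠ 0 := by linarith [lt_one_of_mem_Ioc hq hγ]
  rw [muRatio, muRatio, div_eq_div_iff (mul_ne_zero h1 h2) (mul_ne_zero h1 h3)] at h
  exact mul_left_cancel₀ h1 (by linarith)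

theorem exists_muRatio_eq {q : ℕ} (hq : 2 ≤ q) {x : ℝ} (hx : 0 < x) (hx1 : x ≤ 1) :
    ∃ β ∈ Set.Ioc (0 : ℝ) (((q : ℝ) - 1) / q), muRatio q β = x := by
  have hq' : (2 : ℝ) ≤ q := by exact_mod_cast hq
  have h1 : 0 < (q : ℝ) - 1 := by linarith
  have h2 : 0 < 1 + (q - 1) * x := by positivity
  refine ⟨(q - 1) * x / (1 + (q - 1) * x), ⟨by positivity, ?_⟩, ?_⟩
  · rw [div_le_div_iff₀ h2 (by linarith)]
    nlinarith
  · have h3 : 1 - (q - 1) * x / (1 + (q - 1) * x) = 1 / (1 + (q - 1) * x) := by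
      field_simp
      ring
    rw [muRatio, h3]
    field_simp

theorem prod_muDist {F : Type} [Field F] [DecidableEq F] {q s : ℕ} (hq : 2 ≤ q) {β : ℝ}
    (hβ : β < 1) (w : Fin s → F) :
    ∏ i, muDist q β (w i) = (1 - β) ^ s * muRatio q β ^ wordWt w := by
  rw [← prod_ite_zero_eq_pow_wordWt]
  have : (1 - β) ^ s = ∏ _i : Fin s, (1 - β) := by simp
  rw [this, ← Finset.prod_mul_distrib]
  refine Finset.prod_congr rfl fun i _ => ?_
  rw [muDist, mul_ite, mul_one, one_sub_mul_muRatio hq hβ]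

theorem condWt_eq {F : Type} [Field F] [Fintype F] [DecidableEq F] {q : ℕ} (s : ℕ)
    (hq : 2 ≤ q) {β : ℝ} (hβ : β < 1) :
    condWt F q s β = (∑ w ∈ sumWords F s 0, (wordWt w : ℝ) * muRatio q β ^ wordWt w) /
      (s * ∑ w ∈ sumWords F s 0, muRatio q β ^ wordWt w) := by
  have h : (1 - β) ^ s ≠ 0 := pow_ne_zero _ (by linarith)
  simp_rw [condWt, prod_muDist hq hβ]
  have hnum : ∑ w ∈ sumWords F s 0,
      (1 - β) ^ s * muRatio q β ^ wordWt w * ((wordWt w : ℝ) / s) =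
      (1 - β) ^ s * ((∑ w ∈ sumWords F s 0, (wordWt w : ℝ) * muRatio q β ^ wordWt w) / s) := by
    rw [Finset.sum_div, Finset.mul_sum]
    exact Finset.sum_congr rfl fun w _ => by ring
  rw [hnum, ← Finset.mul_sum, mul_div_mul_left _ _ h, div_div]

theorem sum_pow_wordWt_pos {F : Type} [Field F] [Fintype F] [DecidableEq F] (s : ℕ) {x : ℝ}
    (hx : 0 ≤ x) : 0 < ∑ w ∈ sumWords F s 0, x ^ wordWt w := by
  refine Finset.sum_pos' (fun w _ => pow_nonneg hx _) ⟨0, by simp [sumWords], by simp [wordWt]⟩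

theorem Zfun_eq {F : Type} [Field F] [Fintype F] [DecidableEq F] {q : ℕ}
    (hcard : Fintype.card F = q) (s : ℕ) (hq : 2 ≤ q) {β : ℝ} (hβ : β < 1) :
    Zfun q s β = (1 - β) ^ s * ∑ w ∈ sumWords F s 0, muRatio q β ^ wordWt w := by
  have hq' : (2 : ℝ) ≤ q := by exact_mod_cast hq
  have h1 : (q : ℝ) - 1 ≠ 0 := by linarith
  have hr := one_sub_mul_muRatio hq hβ
  have ha : (1 - β) * (1 + (q - 1) * muRatio q β) = 1 := by
    rw [mul_add, mul_left_comm, hr]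
    field_simp
    ring
  have hb : (1 - β) * (1 - muRatio q β) = 1 - q * β / (q - 1) := by
    rw [mul_sub, hr]
    field_simp
    ring
  rw [sum_pow_wordWt, hcard, if_pos rfl, Zfun, ← mul_div_assoc, mul_add, mul_left_comm, ← mul_pow,
    ← mul_pow, ha, hb, one_pow]

theorem psiFun_eq_s14 {F : Type} [Field F] [Fintype F] [DecidableEq F] {q : ℕ}
    (hcard : Fintype.card F = q) (s : ℕ) (hq : 2 ≤ q) {lam β : ℝ}
    (hlam : lam ∈ Set.Ioc (0 : ℝ) (((q : ℝ) - 1) / q))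
    (hβ : β ∈ Set.Ioc (0 : ℝ) (((q : ℝ) - 1) / q)) :
    psiFun q s lam β =
      (s * (lam * Real.log lam + (1 - lam) * Real.log (1 - lam) - lam * Real.log (q - 1)) +
        (Real.log (∑ w ∈ sumWords F s 0, muRatio q β ^ wordWt w) -
          s * lam * Real.log (muRatio q β))) / Real.log q := by
  have hq' : (2 : ℝ) ≤ q := by exact_mod_cast hq
  have hβ1 := lt_one_of_mem_Ioc hq hβ
  have h1 : (q : ℝ) - 1 ≠ 0 := by linarith
  have h2 : 1 - β ≠ 0 := by linarith
  have h3 : 1 - lam ≠ 0 := by linarith [lt_one_of_mem_Ioc hq hlam]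
  have hP := (sum_pow_wordWt_pos (F := F) s (muRatio_pos hq hβ).le).ne'
  have hx : Real.log (muRatio q β) = Real.log β - (Real.log (q - 1) + Real.log (1 - β)) := by
    rw [muRatio, Real.log_div hβ.1.ne' (mul_ne_zero h1 h2), Real.log_mul h1 h2]
  rw [psiFun, klDiv, Zfun_eq hcard s hq hβ1]
  simp only [Real.logb]
  rw [Real.log_mul (pow_ne_zero _ h2) hP, Real.log_pow, Real.log_div hlam.1.ne' hβ.1.ne',
    Real.log_div h3 h2, hx]
  ring

theorem sum_wordWt_mul {F : Type} [Field F] [Fintype F] [DecidableEq F] {s : ℕ} (hs : 2 ≤ s) :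
    ∑ w ∈ sumWords F s 0, (wordWt w : ℝ) =
      s * ((Fintype.card F - 1) / Fintype.card F * (sumWords F s 0).card) := by
  have hq : (Fintype.card F : ℝ) ≠ 0 := by exact_mod_cast Fintype.card_ne_zero
  obtain ⟨n, rfl⟩ := Nat.exists_eq_add_of_le' hs
  have hcount := sum_pow_wordWt (n + 2) (0 : F) 1
  simp only [one_pow, Finset.sum_const, nsmul_eq_mul, mul_one, sub_self] at hcount
  have hl : HasDerivAt (fun x : ℝ => ∑ w ∈ sumWords F (n + 2) 0, x ^ wordWt w)
      (∑ w ∈ sumWords F (n + 2) 0, (wordWt w : ℝ) * 1 ^ (wordWt w - 1)) 1 :=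
    HasDerivAt.fun_sum fun w _ => hasDerivAt_pow _ _
  have hlin : HasDerivAt (fun x : ℝ => 1 + ((Fintype.card F : ℝ) - 1) * x)
      ((Fintype.card F : ℝ) - 1) 1 := by
    simpa using ((hasDerivAt_id (1 : ℝ)).const_mul ((Fintype.card F : ℝ) - 1)).const_add 1
  have hr := ((hlin.fun_pow (n + 2)).fun_add
    ((((hasDerivAt_id (1 : ℝ)).const_sub 1).fun_pow (n + 2)).const_mul
      ((if (0 : F) = 0 then (Fintype.card F : ℝ) else 0) - 1))).div_const (Fintype.card F : ℝ)
  have h := hl.unique (hr.congr_of_eventuallyEq (.of_forall fun x => sum_pow_wordWt (n + 2) 0 x))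
  simp only [one_pow, mul_one] at h
  rw [h, hcount]
  simp
  field_simp
  ring

theorem exists_condWt_eq {F : Type} [Field F] [Fintype F] [DecidableEq F] {q : ℕ}
    (hcard : Fintype.card F = q) {s : ℕ} (hs : 2 ≤ s) (hq : 2 ≤ q) {lam : ℝ}
    (hlam : lam ∈ Set.Ioc (0 : ℝ) (((q : ℝ) - 1) / q)) :
    ∃ β ∈ Set.Ioc (0 : ℝ) (((q : ℝ) - 1) / q), condWt F q s β = lam := by
  have hs0 : (0 : ℝ) < s := by exact_mod_cast (by omega : 0 < s)
  set g : ℝ → ℝ := fun x => (∑ w ∈ sumWords F s 0, (wordWt w : ℝ) * x ^ wordWt w) /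
    (s * ∑ w ∈ sumWords F s 0, x ^ wordWt w) with hg
  have hcont : ContinuousOn g (Set.Icc 0 1) := by
    refine ContinuousOn.div (by fun_prop) (by fun_prop) fun x hx => ?_
    exact (mul_pos hs0 (sum_pow_wordWt_pos s hx.1)).ne'
  have hg0 : g 0 = 0 := by
    rw [hg]
    refine div_eq_zero_iff.mpr (.inl (Finset.sum_eq_zero fun w _ => ?_))
    rcases Nat.eq_zero_or_pos (wordWt w) with h | h
    · rw [h, Nat.cast_zero, zero_mul]
    · rw [zero_pow h.ne', mul_zero]
  have hg1 : g 1 = ((q : ℝ) - 1) / q := by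
    have hP := sum_pow_wordWt_pos (F := F) s (x := 1) zero_le_one
    simp only [one_pow, Finset.sum_const, nsmul_eq_mul, mul_one] at hP
    simp only [hg, one_pow, mul_one, Finset.sum_const, nsmul_eq_mul]
    rw [sum_wordWt_mul hs, hcard, mul_div_mul_left _ _ hs0.ne', mul_div_cancel_right₀ _ hP.ne']
  obtain ⟨x, hx, hgx⟩ := intermediate_value_Icc zero_le_one hcont
    (by rw [hg0, hg1]; exact ⟨hlam.1.le, hlam.2⟩ : lam ∈ Set.Icc (g 0) (g 1))
  have hx0 : 0 < x := hx.1.lt_of_ne fun h => hlam.1.ne (by rw [← hgx, ← h, hg0])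
  obtain ⟨β, hβ, rfl⟩ := exists_muRatio_eq hq hx0 hx.2
  exact ⟨β, hβ, (condWt_eq s hq (lt_one_of_mem_Ioc hq hβ)).trans hgx⟩

theorem psiFun_lt_of_condWt_eq {F : Type} [Field F] [Fintype F] [DecidableEq F] {q : ℕ}
    (hcard : Fintype.card F = q) {s : ℕ} (hs : 0 < s) (hq : 2 ≤ q) {lam β γ : ℝ}
    (hlam : lam ∈ Set.Ioc (0 : ℝ) (((q : ℝ) - 1) / q))
    (hβ : β ∈ Set.Ioc (0 : ℝ) (((q : ℝ) - 1) / q))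
    (hγ : γ ∈ Set.Ioc (0 : ℝ) (((q : ℝ) - 1) / q))
    (hcond : condWt F q s β = lam) (hne : γ ≠ β) :
    psiFun q s lam β < psiFun q s lam γ := by
  have hs0 : (0 : ℝ) < s := by exact_mod_cast hs
  have hx := muRatio_pos hq hβ
  rw [condWt_eq s hq (lt_one_of_mem_Ioc hq hβ),
    div_eq_iff (mul_pos hs0 (sum_pow_wordWt_pos s hx.le)).ne'] at hcond
  have hlog : 0 < Real.log q := Real.log_pos (by exact_mod_cast hq)
  rw [psiFun_eq_s14 hcard s hq hlam hβ, psiFun_eq_s14 hcard s hq hlam hγ]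
  refine div_lt_div_of_pos_right (add_lt_add_right ?_ _) hlog
  refine log_sum_pow_sub_lt _ _ hx (muRatio_pos hq hγ)
    (fun h => hne (muRatio_injOn hq hγ hβ h)) (by rw [hcond]; ring) ⟨0, by simp [sumWords], ?_⟩
  simpa [wordWt] using (mul_pos hs0 hlam.1).ne

/-- **Lemma 5.4.** For each `λ ∈ (0,(q−1)/q]`, the function `β ↦ ψ(λ,β)`
has a unique minimizer on `(0,(q−1)/q]`, and this minimizer is the unique `β` with
`E_{w∼μ_q(β)^s}[wt(w) | ∑ w_i = 0] = λ`. -/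
theorem psi_unique_minimizer
    (q : ℕ) (F : Type) [Field F] [Fintype F] [DecidableEq F]
    (hcard : Fintype.card F = q) (s : ℕ) (hs : 2 ≤ s)
    (lam : ℝ) (hlam : lam ∈ Set.Ioc (0 : ℝ) (((q : ℝ) - 1) / q)) :
    ∃ β₀ ∈ Set.Ioc (0 : ℝ) (((q : ℝ) - 1) / q),
      (∀ β ∈ Set.Ioc (0 : ℝ) (((q : ℝ) - 1) / q), psiFun q s lam β₀ ≤ psiFun q s lam β) ∧
      (∀ β ∈ Set.Ioc (0 : ℝ) (((q : ℝ) - 1) / q),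
        (∀ β' ∈ Set.Ioc (0 : ℝ) (((q : ℝ) - 1) / q), psiFun q s lam β ≤ psiFun q s lam β') →
        β = β₀) ∧
      condWt F q s β₀ = lam ∧
      (∀ β ∈ Set.Ioc (0 : ℝ) (((q : ℝ) - 1) / q), condWt F q s β = lam → β = β₀) := by
  have hq : 2 ≤ q := hcard ▸ Fintype.one_lt_card
  obtain ⟨β₀, hβ₀, hcond⟩ := exists_condWt_eq hcard hs hq hlam
  have hlt {β γ : ℝ} (hβ : β ∈ Set.Ioc (0 : ℝ) (((q : ℝ) - 1) / q))
      (hγ : γ ∈ Set.Ioc (0 : ℝ) (((q : ℝ) - 1) / q)) (h : condWt F q s β = lam) (hne : γ ≠ β) :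
      psiFun q s lam β < psiFun q s lam γ :=
    psiFun_lt_of_condWt_eq hcard (by omega) hq hlam hβ hγ h hne
  refine ⟨β₀, hβ₀, fun β hβ => ?_, fun β hβ hmin => ?_, hcond, fun β hβ h => ?_⟩
  · rcases eq_or_ne β β₀ with rfl | hne
    · exact le_rfl
    · exact (hlt hβ₀ hβ hcond hne).le
  · by_contra hne
    exact (hmin β₀ hβ₀).not_gt (hlt hβ₀ hβ hcond hne)
  · by_contra hne
    exact lt_asymm (hlt hβ₀ hβ hcond hne) (hlt hβ hβ₀ h (Ne.symm hne))
end

section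
/- Fix a prime power q and an integer s ≥ 1. Then φ(λ) ≥ −1 for every λ ∈ (0, (q−1)/q], and φ((q−1)/q) = −1. -/
open Finset

theorem sub_le_mul_log_div {a b : ℝ} (ha : 0 < a) (hb : 0 < b) :
    a - b ≤ a * Real.log (a / b) := by
  have h := mul_le_mul_of_nonneg_left (Real.one_sub_inv_le_log_of_pos (div_pos ha hb)) ha.le
  have h' : a * (1 - (a / b)⁻¹) = a - b := by field_simp
  linarith

theorem klDiv_nonneg {q : ℕ} (hq : 1 < q) {lam β : ℝ} (hlam : 0 < lam) (hlam_lt : lam < 1)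
    (hβ : 0 < β) (hβ_lt : β < 1) : 0 ≤ klDiv q lam β := by
  have hlog : 0 < Real.log q := Real.log_pos (by exact_mod_cast hq)
  have h₁ := sub_le_mul_log_div hlam hβ
  have h₂ := sub_le_mul_log_div (sub_pos.2 hlam_lt) (sub_pos.2 hβ_lt)
  have key : klDiv q lam β = (lam * Real.log (lam / β) +
      (1 - lam) * Real.log ((1 - lam) / (1 - β))) / Real.log q := by
    unfold klDiv Real.logb
    ring
  rw [key]
  exact div_nonneg (by linarith) hlog.le

theorem klDiv_self (q : ℕ) {x : ℝ} (hx : x ≠ 0) (hx' : 1 - x ≠ 0) : klDiv q x x = 0 := by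
  simp [klDiv, div_self hx, div_self hx']

theorem inv_le_Zfun {q : ℕ} (hq : 1 < q) (s : ℕ) {β : ℝ} (hβ : β ≤ ((q : ℝ) - 1) / q) :
    (q : ℝ)⁻¹ ≤ Zfun q s β := by
  have hq' : (1 : ℝ) < q := by exact_mod_cast hq
  have hq0 : (0 : ℝ) < q := by linarith
  have hq1 : (0 : ℝ) < q - 1 := by linarith
  have hβ' : (q : ℝ) * β / (q - 1) ≤ 1 := by
    rw [div_le_one hq1, mul_comm]
    exact (le_div_iff₀ hq0).1 hβ
  have hpow : 0 ≤ ((q : ℝ) - 1) * (1 - q * β / (q - 1)) ^ s :=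
    mul_nonneg hq1.le (pow_nonneg (by linarith) s)
  rw [Zfun, inv_eq_one_div]
  gcongr
  linarith

theorem Zfun_uniform {q s : ℕ} (hq : 1 < q) (hs : s ≠ 0) :
    Zfun q s (((q : ℝ) - 1) / q) = (q : ℝ)⁻¹ := by
  have hq' : (1 : ℝ) < q := by exact_mod_cast hq
  have hq0 : (q : ℝ) ≠ 0 := by linarith
  have hq1 : (q : ℝ) - 1 ≠ 0 := by linarith
  rw [Zfun, mul_div_cancel₀ _ hq0, div_self hq1]
  simp [hs]

theorem logb_inv_base {b : ℝ} (hb : 1 < b) : Real.logb b b⁻¹ = -1 := by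
  rw [Real.logb_inv, Real.logb_self_eq_one hb]

theorem neg_one_le_psiFun {q : ℕ} (hq : 1 < q) (s : ℕ) {lam β : ℝ}
    (hlam : lam ∈ Set.Ioc (0 : ℝ) (((q : ℝ) - 1) / q))
    (hβ : β ∈ Set.Ioc (0 : ℝ) (((q : ℝ) - 1) / q)) : -1 ≤ psiFun q s lam β := by
  have hq' : (1 : ℝ) < q := by exact_mod_cast hq
  have hq0 : (0 : ℝ) < q := by linarith
  have hlt : ((q : ℝ) - 1) / q < 1 := by
    rw [div_lt_one hq0]
    linarith
  have hkl := klDiv_nonneg hq hlam.1 (hlam.2.trans_lt hlt) hβ.1 (hβ.2.trans_lt hlt)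
  have hZ : -1 ≤ Real.logb q (Zfun q s β) := by
    rw [← logb_inv_base hq']
    exact Real.logb_le_logb_of_le hq' (inv_pos.2 hq0) (inv_le_Zfun hq s hβ.2)
  have := mul_nonneg (Nat.cast_nonneg (α := ℝ) s) hkl
  unfold psiFun
  linarith

/-- **Claim 5.10.** `φ(λ) ≥ −1` for every `λ ∈ (0,(q−1)/q]`, and
`φ((q−1)/q) = −1`. -/
theorem phi_ge_neg_one
    (q : ℕ) (F : Type) [Field F] [Fintype F] [DecidableEq F]
    (hcard : Fintype.card F = q) (s : ℕ) (hs : 1 ≤ s) :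
    (∀ lam ∈ Set.Ioc (0 : ℝ) (((q : ℝ) - 1) / q), -1 ≤ phiFun q s lam) ∧
    phiFun q s (((q : ℝ) - 1) / q) = -1 := by
  have hq : 1 < q := hcard ▸ Fintype.one_lt_card
  have hq' : (1 : ℝ) < q := by exact_mod_cast hq
  have hq0 : (0 : ℝ) < q := by linarith
  have hmem : ((q : ℝ) - 1) / q ∈ Set.Ioc (0 : ℝ) (((q : ℝ) - 1) / q) :=
    ⟨div_pos (by linarith) hq0, le_rfl⟩
  have hbound : ∀ lam ∈ Set.Ioc (0 : ℝ) (((q : ℝ) - 1) / q), -1 ≤ phiFun q s lam := by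
    intro lam hlam
    refine le_csInf (Set.Nonempty.image _ ⟨_, hmem⟩) ?_
    rintro _ ⟨β, hβ, rfl⟩
    exact neg_one_le_psiFun hq s hlam hβ
  refine ⟨hbound, le_antisymm ?_ (hbound _ hmem)⟩
  refine csInf_le ⟨-1, ?_⟩ ⟨_, hmem, ?_⟩
  · rintro _ ⟨β, hβ, rfl⟩
    exact neg_one_le_psiFun hq s hmem hβ
  · have hne : 1 - ((q : ℝ) - 1) / q ≠ 0 := by
      have : 1 - ((q : ℝ) - 1) / q = (q : ℝ)⁻¹ := by
        field_simp
        ring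
      rw [this]
      exact inv_ne_zero hq0.ne'
    rw [psiFun, klDiv_self q hmem.1.ne' hne, Zfun_uniform hq (by omega), logb_inv_base hq']
    simp
end
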